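/- arXiv:2510.17310 — 3 statements merged into one kernel-verified Lean document; each statement's English description precedes it below -/
import Mathlib

section
/- Let n ∈ ℕ and let p satisfy 2n < p ≤ 2(n+1). Then there exist a closed subspace Z_n of c0 that fails the approximation property and a closed subalgebra M_n of the operator-norm closure of QN_p(Z_n) in L(Z_n) such that M_n is a closed (n+1)-subideal of L(Z_n) but not a closed n-subideal of L(Z_n). -/
open Filter Topology
open scoped ENNReal

set_option synthInstance.maxHeartbeats 1000000
set_option maxHeartbeats 4000000

noncomputable section

/-- `J` is a two-sided ideal of the subalgebra `I`. -/
def IsIdealOf {𝕜 A : Type*} [CommSemiring 𝕜] [NonUnitalNonAssocSemiring A] [Module 𝕜 A]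
    (J I : NonUnitalSubalgebra 𝕜 A) : Prop :=
  (J : Set A) ⊆ (I : Set A) ∧ ∀ a ∈ I, ∀ x ∈ J, a * x ∈ J ∧ x * a ∈ J

/-- The set `S` is a closed `n`-subideal of the algebra `A`. -/
def IsClosedNSubideal (𝕜 : Type*) {A : Type*} [CommSemiring 𝕜] [NonUnitalNonAssocSemiring A]
    [Module 𝕜 A] [TopologicalSpace A] (n : ℕ) (S : Set A) : Prop :=
  ∃ C : ℕ → NonUnitalSubalgebra 𝕜 A, (C 0 : Set A) = Set.univ ∧ (C n : Set A) = S ∧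
    (∀ k ≤ n, IsClosed (C k : Set A)) ∧ ∀ k < n, IsIdealOf (C (k + 1)) (C k)

/-- The bounded finite-rank operators from `X` to `Y`. -/
def finRankOps (𝕜 X Y : Type*) [NontriviallyNormedField 𝕜] [NormedAddCommGroup X]
    [NormedSpace 𝕜 X] [NormedAddCommGroup Y] [NormedSpace 𝕜 Y] : Set (X →L[𝕜] Y) :=
  {T | FiniteDimensional 𝕜 (LinearMap.range (T : X →ₗ[𝕜] Y))}

/-- The Banach space `X` has the approximation property. -/
def HasApproximationProperty (𝕜 X : Type*) [NontriviallyNormedField 𝕜] [NormedAddCommGroup X]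
    [NormedSpace 𝕜 X] : Prop :=
  ∀ C : Set X, IsCompact C → ∀ ε : ℝ, 0 < ε →
    ∃ T : X →L[𝕜] X, T ∈ finRankOps 𝕜 X X ∧ ∀ x ∈ C, ‖T x - x‖ ≤ ε

/-- A bundled carrier with its norm structure. -/
structure BundledSp (𝕜 : Type*) [NontriviallyNormedField 𝕜] where
  carrier : Type
  [grp : NormedAddCommGroup carrier]
  [mod : NormedSpace 𝕜 carrier]

attribute [instance] BundledSp.grp BundledSp.mod

/-- `T` is a quasi `p`-nuclear operator: there is a sequence `(x*_k)` in the dual with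
`Σ_k ‖x*_k‖^p < ∞` and `‖Tx‖ ≤ (Σ_k |x*_k(x)|^p)^{1/p}` for all `x`. -/
def IsQuasiPNuclear {𝕜 X Y : Type*} [NontriviallyNormedField 𝕜] [NormedAddCommGroup X]
    [NormedSpace 𝕜 X] [NormedAddCommGroup Y] [NormedSpace 𝕜 Y] (p : ℝ)
    (T : X →L[𝕜] Y) : Prop :=
  ∃ f : ℕ → (X →L[𝕜] 𝕜), (Summable fun k => ‖f k‖ ^ p) ∧
    ∀ x : X, ‖T x‖ ≤ (∑' k, ‖f k x‖ ^ p) ^ (1 / p)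

/-- The nontrivial real character of `ZMod 2`. -/
def sgn (a : ZMod 2) : ℝ := if a = 0 then 1 else -1

lemma zmod_two_eq_zero_or_one : ∀ a : ZMod 2, a = 0 ∨ a = 1 := by decide

lemma zmod_two_eq_one_of_ne_zero {a : ZMod 2} (h : a ≠ 0) : a = 1 :=
  (zmod_two_eq_zero_or_one a).resolve_left h

lemma sgn_zero : sgn 0 = 1 := by simp [sgn]

lemma sgn_one : sgn 1 = -1 := by simp [sgn]

lemma sgn_add (a b : ZMod 2) : sgn (a + b) = sgn a * sgn b := by
  have h : (1 : ZMod 2) + 1 = 0 := by decide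
  obtain rfl | rfl := zmod_two_eq_zero_or_one a <;>
    obtain rfl | rfl := zmod_two_eq_zero_or_one b <;> simp [sgn_zero, sgn_one, h]

lemma abs_sgn (a : ZMod 2) : |sgn a| = 1 := by
  obtain rfl | rfl := zmod_two_eq_zero_or_one a <;> simp [sgn_zero, sgn_one]

/-- A character sum over a finite group of exponent two vanishes as soon as the character is
nontrivial. -/
lemma sum_sgn_eq_zero {U : Type*} [AddCommGroup U] [Fintype U] (f : U → ZMod 2) (u₀ : U)
    (h : ∀ u, f (u + u₀) = f u + 1) : ∑ u, sgn (f u) = 0 := by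
  have h1 : ∑ u, sgn (f (u + u₀)) = ∑ u, sgn (f u) :=
    Equiv.sum_comp (Equiv.addRight u₀) (fun u => sgn (f u))
  simp only [h, sgn_add, sgn_one, mul_neg, mul_one, Finset.sum_neg_distrib] at h1
  linarith

/-- Pairs of bit strings of length `K`. -/
abbrev BitPair (K : ℕ) : Type := (Fin K → ZMod 2) × (Fin K → ZMod 2)

/-- The dual coordinates of `BitPair K`, with one additional bit. -/
abbrev Freq (K : ℕ) : Type := (Fin K → ZMod 2) × (Fin K → ZMod 2) × ZMod 2

/-- The bilinear pairing of frequencies. -/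
def pairing {K : ℕ} (g a : Freq K) : ZMod 2 :=
  g.1 ⬝ᵥ a.1 + g.2.1 ⬝ᵥ a.2.1 + g.2.2 * a.2.2

lemma pairing_add_left {K : ℕ} (g h a : Freq K) :
    pairing (g + h) a = pairing g a + pairing h a := by
  simp only [pairing, Prod.fst_add, Prod.snd_add, add_dotProduct]; ring

lemma pairing_add_right {K : ℕ} (g a b : Freq K) :
    pairing g (a + b) = pairing g a + pairing g b := by
  simp only [pairing, Prod.fst_add, Prod.snd_add, dotProduct_add]; ring

lemma exists_pairing_eq_one {K : ℕ} {a : Freq K} (h : a ≠ 0) : ∃ g, pairing g a = 1 := by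
  by_contra! hc
  apply h
  refine Prod.ext (funext fun i => ?_) (Prod.ext (funext fun i => ?_) ?_) <;> by_contra h0
  · exact hc (Pi.single i 1, 0, 0) (by simpa [pairing] using zmod_two_eq_one_of_ne_zero h0)
  · exact hc (0, Pi.single i 1, 0) (by simpa [pairing] using zmod_two_eq_one_of_ne_zero h0)
  · exact hc (0, 0, 1) (by simpa [pairing] using zmod_two_eq_one_of_ne_zero h0)

lemma add_ne_zero_of_ne {K : ℕ} {g h : Freq K} (hgh : g ≠ h) : g + h ≠ 0 := fun h0 => hgh (by
  rw [eq_neg_of_add_eq_zero_left h0]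
  refine Prod.ext (funext fun i => ?_) (Prod.ext (funext fun i => ?_) ?_) <;>
    simp [ZMod.neg_eq_self_mod_two])

lemma sum_sgn_pairing {K : ℕ} (a b : Freq K) (c : ZMod 2) (h : a ≠ b) :
    ∑ g : Freq K, sgn (pairing g a + pairing g b + c) = 0 := by
  have hab : a + b ≠ 0 := add_ne_zero_of_ne h
  obtain ⟨g₀, hg₀⟩ := exists_pairing_eq_one hab
  refine sum_sgn_eq_zero _ g₀ fun g => ?_
  rw [pairing_add_right] at hg₀
  rw [pairing_add_left, pairing_add_left]
  linear_combination hg₀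

/-- The `m`-th bit, `0` beyond the length. -/
def bit {K : ℕ} (y : Fin K → ZMod 2) (m : ℕ) : ZMod 2 := if h : m < K then y ⟨m, h⟩ else 0

/-- The shifted scalar product `∑ x_i y_{i+s}`. -/
def shiftForm {K : ℕ} (s : ℕ) (j : BitPair K) : ZMod 2 := ∑ i, j.1 i * bit j.2 (i + s)

/-- The scalar product of the strings without their last bits. -/
def truncForm {K : ℕ} (j : BitPair K) : ZMod 2 :=
  ∑ i : Fin K, j.1 i * if (i : ℕ) + 1 < K then j.2 i else 0

lemma abs_sum_sgn_le {K : ℕ} (ℓ : Fin K → (Fin K → ZMod 2) → ZMod 2)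
    (r : (Fin K → ZMod 2) → ZMod 2) (hℓ : ∀ y y' : Fin K → ZMod 2, (∀ i, ℓ i y = 0) →
      (∀ i, ℓ i y' = 0) → ∀ m, 3 ≤ m → m + 1 < K → (∀ l < m, bit y l = bit y' l) →
      bit y m = bit y' m) :
    |∑ j : BitPair K, sgn (∑ i, j.1 i * ℓ i j.2 + r j.2)| ≤ 16 * 2 ^ K := by
  classical
  rw [Fintype.sum_prod_type_right]
  have h1 : ∀ y : Fin K → ZMod 2, |∑ x : Fin K → ZMod 2, sgn (∑ i, x i * ℓ i y + r y)| ≤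
      if ∀ i, ℓ i y = 0 then (2 : ℝ) ^ K else 0 := by
    intro y
    split_ifs with h
    · refine (Finset.abs_sum_le_sum_abs _ _).trans ?_
      simp [abs_sgn]
    · push Not at h
      obtain ⟨i, hi⟩ := h
      rw [sum_sgn_eq_zero _ (Pi.single i 1), abs_zero]
      intro u
      have : ∑ k, (u + Pi.single i 1 : Fin K → ZMod 2) k * ℓ k y = ∑ k, u k * ℓ k y + ℓ i y := by
        simp [add_mul, Finset.sum_add_distrib, Pi.single_apply]
      rw [this, zmod_two_eq_one_of_ne_zero hi]; ring
  refine (Finset.abs_sum_le_sum_abs _ _).trans ((Finset.sum_le_sum fun y _ => h1 y).trans ?_)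
  rw [← Finset.sum_filter, Finset.sum_const, nsmul_eq_mul]
  gcongr
  have h2 : (Finset.univ.filter fun y : Fin K → ZMod 2 => ∀ i, ℓ i y = 0).card ≤
      (Finset.univ : Finset (Fin 4 → ZMod 2)).card := by
    refine Finset.card_le_card_of_injOn
      (fun y => ![bit y 0, bit y 1, bit y 2, bit y (K - 1)]) (fun _ _ => Finset.mem_univ _) ?_
    intro y hy y' hy' hyy
    simp only [Finset.coe_filter, Finset.mem_univ, true_and, Set.mem_ofPred_eq] at hy hy'
    have e0 : bit y 0 = bit y' 0 := congrFun hyy 0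
    have e1 : bit y 1 = bit y' 1 := congrFun hyy 1
    have e2 : bit y 2 = bit y' 2 := congrFun hyy 2
    have e3 : bit y (K - 1) = bit y' (K - 1) := congrFun hyy 3
    have key : ∀ m, bit y m = bit y' m := by
      intro m
      induction m using Nat.strong_induction_on with
      | _ m ih =>
        rcases lt_or_ge m 3 with hm | hm
        · interval_cases m <;> assumption
        rcases lt_trichotomy (m + 1) K with h | h | h
        · exact hℓ y y' hy hy' m hm h ih
        · have : m = K - 1 := by omega
          rw [this, e3]
        · simp [bit, show ¬ m < K by omega]
    funext i
    simpa [bit] using key i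
  have h3 : (Finset.univ : Finset (Fin 4 → ZMod 2)).card = 16 := by simp
  rw [h3] at h2
  exact_mod_cast h2

/-- The characters attached to the current level. -/
def freqUp (k : ℕ) (j : BitPair (k + 1)) : Freq (k + 1) := (j.1, j.2, truncForm j)

/-- The characters attached to the next level. -/
def freqDown (k : ℕ) (j : BitPair (k + 1)) : Freq (k + 2) :=
  (Fin.snoc j.1 (shiftForm 1 j), Fin.snoc j.2 (shiftForm 2 j), shiftForm 0 j + 1)

def tauSign (k : ℕ) (g : Freq (k + 1)) (j : BitPair (k + 1)) : ℝ := sgn (pairing g (freqUp k j))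

def sigmaSign (k : ℕ) (g : Freq (k + 2)) (j : BitPair (k + 1)) : ℝ :=
  sgn (pairing g (freqDown k j) + shiftForm 3 j)

lemma freqUp_injective (k : ℕ) : Function.Injective (freqUp k) := fun i j h => by
  simp only [freqUp, Prod.mk.injEq] at h
  exact Prod.ext h.1 h.2.1

lemma freqDown_injective (k : ℕ) : Function.Injective (freqDown k) := fun i j h => by
  simp only [freqDown, Prod.mk.injEq] at h
  refine Prod.ext ?_ ?_
  · simpa using congrArg (Fin.init (α := fun _ => ZMod 2)) h.1
  · simpa using congrArg (Fin.init (α := fun _ => ZMod 2)) h.2.1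

lemma freqDown_ne_freqUp (k : ℕ) (i : BitPair (k + 1)) (j : BitPair (k + 2)) :
    freqDown k i ≠ freqUp (k + 1) j := by
  intro h
  simp only [freqDown, freqUp, Prod.mk.injEq] at h
  obtain ⟨h1, h2, h3⟩ := h
  have : truncForm j = shiftForm 0 i := by
    rw [truncForm, Fin.sum_univ_castSucc, ← h1, ← h2]
    simp [shiftForm, bit]
  rw [this] at h3
  simp at h3

lemma sgn_mul_self (a : ZMod 2) : sgn a * sgn a = 1 := by
  rw [← sgn_add, CharTwo.add_self_eq_zero, sgn_zero]

lemma sum_tau_tau (k : ℕ) (i j : BitPair (k + 1)) :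
    ∑ g, tauSign k g i * tauSign k g j = if i = j then (Fintype.card (Freq (k + 1)) : ℝ) else 0 := by
  split_ifs with h
  · subst h; simp [tauSign, sgn_mul_self]
  · simp only [tauSign, ← sgn_add]
    simpa using sum_sgn_pairing _ _ 0 ((freqUp_injective k).ne h)

lemma sum_sigma_sigma (k : ℕ) (i j : BitPair (k + 1)) :
    ∑ g, sigmaSign k g i * sigmaSign k g j =
      if i = j then (Fintype.card (Freq (k + 2)) : ℝ) else 0 := by
  split_ifs with h
  · subst h; simp [sigmaSign, sgn_mul_self]
  · simp only [sigmaSign, ← sgn_add]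
    rw [← sum_sgn_pairing _ _ (shiftForm 3 i + shiftForm 3 j) ((freqDown_injective k).ne h)]
    exact Finset.sum_congr rfl fun g _ => by congr 1; ring

lemma sum_sigma_tau (k : ℕ) (i : BitPair (k + 1)) (j : BitPair (k + 2)) :
    ∑ g, sigmaSign k g i * tauSign (k + 1) g j = 0 := by
  simp only [sigmaSign, tauSign, ← sgn_add]
  rw [← sum_sgn_pairing _ _ (shiftForm 3 i) (freqDown_ne_freqUp k i j)]
  exact Finset.sum_congr rfl fun g _ => by congr 1; ring

lemma sum_sgn_linear {K : ℕ} (u w : Fin K → ZMod 2) (c : ZMod 2) (h : u ≠ 0 ∨ w ≠ 0) :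
    ∑ j : BitPair K, sgn (u ⬝ᵥ j.1 + w ⬝ᵥ j.2 + c) = 0 := by
  obtain h | h := h
  · obtain ⟨i, hi⟩ := Function.ne_iff.1 h
    refine sum_sgn_eq_zero _ (Pi.single i 1, 0) fun j => ?_
    simp [dotProduct_add, zmod_two_eq_one_of_ne_zero hi]; ring
  · obtain ⟨i, hi⟩ := Function.ne_iff.1 h
    refine sum_sgn_eq_zero _ (0, Pi.single i 1) fun j => ?_
    simp [dotProduct_add, zmod_two_eq_one_of_ne_zero hi]; ring

lemma abs_sum_freqUp_le (k : ℕ) {d : Freq (k + 1)} (hd : d ≠ 0) :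
    |∑ j, sgn (pairing d (freqUp k j))| ≤ 16 * 2 ^ (k + 1) := by
  obtain ⟨u, w, v⟩ := d
  obtain rfl | rfl := zmod_two_eq_zero_or_one v
  · have h : u ≠ 0 ∨ w ≠ 0 := by
      by_contra! h; exact hd (by simp [h.1, h.2])
    have := sum_sgn_linear u w 0 h
    simp only [add_zero] at this
    simp only [pairing, freqUp, zero_mul, add_zero, this, abs_zero]
    positivity
  · have := abs_sum_sgn_le (K := k + 1)
      (fun i y => u i + if (i : ℕ) + 1 < k + 1 then y i else 0) (fun y => w ⬝ᵥ y) ?_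
    · convert this using 5 with j
      simp only [pairing, freqUp, truncForm, dotProduct, mul_add, Finset.sum_add_distrib]
      simp only [mul_comm (u _)]
      ring
    · intro y y' hy hy' m _ hm _
      have e := hy ⟨m, by omega⟩
      have e' := hy' ⟨m, by omega⟩
      simp only [hm, if_true] at e e'
      simp only [bit, show m < k + 1 by omega, dif_pos]
      linear_combination e - e'

lemma pairing_freqDown (k : ℕ) (d : Freq (k + 2)) (j : BitPair (k + 1)) :
    pairing d (freqDown k j) = ∑ i, j.1 i * (d.1 i.castSucc + d.2.2 * bit j.2 i +
      d.1 (Fin.last _) * bit j.2 (i + 1) + d.2.1 (Fin.last _) * bit j.2 (i + 2)) +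
      ((fun i : Fin (k + 1) => d.2.1 i.castSucc) ⬝ᵥ j.2 + d.2.2) := by
  simp only [pairing, freqDown, dotProduct, Fin.sum_univ_castSucc (n := k + 1), Fin.snoc_castSucc,
    Fin.snoc_last, shiftForm, mul_add, Finset.sum_add_distrib, Finset.mul_sum, add_zero]
  simp only [mul_left_comm (j.1 _), mul_comm (j.1 _) (d.1 _)]
  ring

lemma abs_sum_freqDown_le (k : ℕ) {d : Freq (k + 2)} (hd : d ≠ 0) :
    |∑ j, sgn (pairing d (freqDown k j))| ≤ 16 * 2 ^ (k + 1) := by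
  simp only [pairing_freqDown]
  obtain ⟨u, w, v⟩ := d
  dsimp only
  by_cases h0 : v = 0 ∧ u (Fin.last _) = 0 ∧ w (Fin.last _) = 0
  · obtain ⟨rfl, hu, hw⟩ := h0
    have h : (fun i : Fin (k + 1) => u i.castSucc) ≠ 0 ∨
        (fun i : Fin (k + 1) => w i.castSucc) ≠ 0 := by
      by_contra! h
      refine hd (Prod.ext (funext fun i => ?_) (Prod.ext (funext fun i => ?_) rfl))
      · exact Fin.lastCases hu (fun i => congrFun h.1 i) i
      · exact Fin.lastCases hw (fun i => congrFun h.2 i) i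
    have := sum_sgn_linear _ _ 0 h
    simp only [hu, hw, zero_mul, add_zero]
    simp only [dotProduct, add_zero, mul_comm (u _)] at this
    simp only [dotProduct, this, abs_zero]
    positivity
  · refine abs_sum_sgn_le (K := k + 1) (fun i y => u i.castSucc + v * bit y i +
      u (Fin.last _) * bit y (i + 1) + w (Fin.last _) * bit y (i + 2))
      (fun y => (fun i : Fin (k + 1) => w i.castSucc) ⬝ᵥ y + v) ?_
    intro y y' hy hy' m hm3 hm hag
    have e0 := (hy ⟨m, by omega⟩).trans (hy' ⟨m, by omega⟩).symm
    have e1 := (hy ⟨m - 1, by omega⟩).trans (hy' ⟨m - 1, by omega⟩).symm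
    have e2 := (hy ⟨m - 2, by omega⟩).trans (hy' ⟨m - 2, by omega⟩).symm
    simp only [show m - 1 + 1 = m by omega, show m - 2 + 2 = m by omega,
      show m - 2 + 1 = m - 1 by omega] at e0 e1 e2
    have a1 := hag (m - 1) (by omega)
    have a2 := hag (m - 2) (by omega)
    rw [a1] at e1 e2
    rw [a2] at e2
    obtain hw | hw := zmod_two_eq_zero_or_one (w (Fin.last _))
    · obtain hu | hu := zmod_two_eq_zero_or_one (u (Fin.last _))
      · have hv := zmod_two_eq_one_of_ne_zero fun hv => h0 ⟨hv, hu, hw⟩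
        rw [hu, hw, hv] at e0
        linear_combination e0
      · rw [hu, hw] at e1
        linear_combination e1
    · rw [hw] at e2
      linear_combination e2

lemma abs_sum_tau_sigma_le (k : ℕ) (g : Freq (k + 1)) (h : Freq (k + 2)) :
    |∑ j, tauSign k g j * sigmaSign k h j| ≤ 16 * 2 ^ (k + 1) := by
  simp only [tauSign, sigmaSign, ← sgn_add, pairing_freqDown]
  have := abs_sum_sgn_le (K := k + 1)
    (fun i y => g.1 i + g.2.2 * (if (i : ℕ) + 1 < k + 1 then y i else 0) +
      (h.1 i.castSucc + h.2.2 * bit y i + h.1 (Fin.last _) * bit y (i + 1) +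
        h.2.1 (Fin.last _) * bit y (i + 2)) + bit y (i + 3))
    (fun y => g.2.1 ⬝ᵥ y + ((fun i : Fin (k + 1) => h.2.1 i.castSucc) ⬝ᵥ y + h.2.2)) ?_
  · convert this using 4 with j
    simp only [mul_add, Finset.sum_add_distrib, pairing, freqUp, truncForm, shiftForm,
      Finset.mul_sum, mul_left_comm (j.1 _) g.2.2]
    simp only [dotProduct, mul_comm (g.1 _)]
    ring
  · intro y y' hy hy' m hm3 hm hag
    have e := (hy ⟨m - 3, by omega⟩).trans (hy' ⟨m - 3, by omega⟩).symm
    simp only [show m - 3 + 3 = m by omega, show m - 3 + 2 = m - 1 by omega,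
      show m - 3 + 1 = m - 2 by omega, hag (m - 1) (by omega), hag (m - 2) (by omega),
      hag (m - 3) (by omega)] at e
    have a : y ⟨m - 3, by omega⟩ = y' ⟨m - 3, by omega⟩ := by
      simpa [bit, show m - 3 < k + 1 by omega] using hag (m - 3) (by omega)
    rw [a] at e
    exact add_left_cancel e

lemma sum_tau_mul_tau (k : ℕ) (g : Freq (k + 1)) :
    ∑ j, tauSign k g j * tauSign k g j = Fintype.card (BitPair (k + 1)) := by
  simp [tauSign, sgn_mul_self]

lemma sum_sigma_mul_sigma (k : ℕ) (g : Freq (k + 2)) :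
    ∑ j, sigmaSign k g j * sigmaSign k g j = Fintype.card (BitPair (k + 1)) := by
  simp [sigmaSign, sgn_mul_self]

lemma abs_sum_tau_tau_le (k : ℕ) {g h : Freq (k + 1)} (hgh : g ≠ h) :
    |∑ j, tauSign k g j * tauSign k h j| ≤ 16 * 2 ^ (k + 1) := by
  simpa only [tauSign, ← sgn_add, ← pairing_add_left] using
    abs_sum_freqUp_le k (add_ne_zero_of_ne hgh)

lemma abs_sum_sigma_sigma_le (k : ℕ) {g h : Freq (k + 2)} (hgh : g ≠ h) :
    |∑ j, sigmaSign k g j * sigmaSign k h j| ≤ 16 * 2 ^ (k + 1) := by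
  simpa only [sigmaSign, ← sgn_add, add_add_add_comm, ← pairing_add_left,
    CharTwo.add_self_eq_zero, add_zero] using abs_sum_freqDown_le k (add_ne_zero_of_ne hgh)

/-- The coordinate set of the construction, a disjoint union of finite levels. -/
abbrev DaviePoint : Type := Σ k : ℕ, Freq (k + 1)

/-- The vectors generating the space. -/
def davieVec (k : ℕ) (j : BitPair (k + 1)) : DaviePoint →₀ ℝ :=
  ∑ g, Finsupp.single ⟨k, g⟩ (tauSign k g j) + ∑ g, Finsupp.single ⟨k + 1, g⟩ (sigmaSign k g j)

lemma davieVec_apply_self (k : ℕ) (j : BitPair (k + 1)) (g : Freq (k + 1)) :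
    davieVec k j ⟨k, g⟩ = tauSign k g j := by
  simp [davieVec, Finsupp.single_apply]

lemma davieVec_apply_succ (k : ℕ) (j : BitPair (k + 1)) (g : Freq (k + 2)) :
    davieVec k j ⟨k + 1, g⟩ = sigmaSign k g j := by
  simp [davieVec, Finsupp.single_apply]

lemma davieVec_apply_of_ne {k : ℕ} (j : BitPair (k + 1)) {h : DaviePoint} (h1 : h.1 ≠ k)
    (h2 : h.1 ≠ k + 1) : davieVec k j h = 0 := by
  obtain ⟨l, h⟩ := h
  simp only [davieVec, Finsupp.add_apply, Finsupp.finsetSum_apply, Finsupp.single_apply,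
    Sigma.mk.injEq]
  simp [Ne.symm h1, Ne.symm h2]

/-- The average of the generators against the characters of the current level. -/
def davieUp (k : ℕ) (g : Freq (k + 1)) : DaviePoint →₀ ℝ :=
  (Fintype.card (BitPair (k + 1)) : ℝ)⁻¹ • ∑ j, tauSign k g j • davieVec k j

/-- The average of the generators against the characters of the next level. -/
def davieDown (k : ℕ) (g : Freq (k + 2)) : DaviePoint →₀ ℝ :=
  (Fintype.card (BitPair (k + 1)) : ℝ)⁻¹ • ∑ j, sigmaSign k g j • davieVec k j

/-- A square-zero matrix of trace one, given by its rows. -/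
def davieRow : DaviePoint → DaviePoint →₀ ℝ
  | ⟨0, g⟩ => (Fintype.card (Freq 1) : ℝ)⁻¹ • davieUp 0 g
  | ⟨k + 1, g⟩ => (Fintype.card (Freq (k + 2)) : ℝ)⁻¹ • (davieUp (k + 1) g - davieDown k g)

lemma sum_tau_smul_up (k : ℕ) (i : BitPair (k + 1)) :
    ∑ g, tauSign k g i • (Fintype.card (Freq (k + 1)) : ℝ)⁻¹ • davieUp k g =
      (Fintype.card (BitPair (k + 1)) : ℝ)⁻¹ • davieVec k i := by
  have hc : (Fintype.card (Freq (k + 1)) : ℝ) ≠ 0 := by positivity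
  simp only [davieUp, Finset.smul_sum, smul_smul]
  rw [Finset.sum_comm]
  have : ∀ j, ∑ g, (tauSign k g i * ((Fintype.card (Freq (k + 1)) : ℝ)⁻¹ *
      ((Fintype.card (BitPair (k + 1)) : ℝ)⁻¹ * tauSign k g j))) • davieVec k j =
      if i = j then (Fintype.card (BitPair (k + 1)) : ℝ)⁻¹ • davieVec k j else 0 := by
    intro j
    rw [← Finset.sum_smul]
    have h2 : ∑ g, tauSign k g i * ((Fintype.card (Freq (k + 1)) : ℝ)⁻¹ *
      ((Fintype.card (BitPair (k + 1)) : ℝ)⁻¹ * tauSign k g j)) =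
      ((Fintype.card (Freq (k + 1)) : ℝ)⁻¹ * (Fintype.card (BitPair (k + 1)) : ℝ)⁻¹) *
        ∑ g, tauSign k g i * tauSign k g j := by
      rw [Finset.mul_sum]; exact Finset.sum_congr rfl fun _ _ => by ring
    rw [h2, sum_tau_tau]
    split_ifs with h
    · congr 1; field_simp
    · simp
  simp only [this, Finset.sum_ite_eq, Finset.mem_univ, if_true]

lemma sum_sigma_smul_down (k : ℕ) (i : BitPair (k + 1)) :
    ∑ g, sigmaSign k g i • (Fintype.card (Freq (k + 2)) : ℝ)⁻¹ • davieDown k g =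
      (Fintype.card (BitPair (k + 1)) : ℝ)⁻¹ • davieVec k i := by
  have hc : (Fintype.card (Freq (k + 2)) : ℝ) ≠ 0 := by positivity
  simp only [davieDown, Finset.smul_sum, smul_smul]
  rw [Finset.sum_comm]
  have : ∀ j, ∑ g, (sigmaSign k g i * ((Fintype.card (Freq (k + 2)) : ℝ)⁻¹ *
      ((Fintype.card (BitPair (k + 1)) : ℝ)⁻¹ * sigmaSign k g j))) • davieVec k j =
      if i = j then (Fintype.card (BitPair (k + 1)) : ℝ)⁻¹ • davieVec k j else 0 := by
    intro j
    rw [← Finset.sum_smul]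
    have h2 : ∑ g, sigmaSign k g i * ((Fintype.card (Freq (k + 2)) : ℝ)⁻¹ *
      ((Fintype.card (BitPair (k + 1)) : ℝ)⁻¹ * sigmaSign k g j)) =
      ((Fintype.card (Freq (k + 2)) : ℝ)⁻¹ * (Fintype.card (BitPair (k + 1)) : ℝ)⁻¹) *
        ∑ g, sigmaSign k g i * sigmaSign k g j := by
      rw [Finset.mul_sum]; exact Finset.sum_congr rfl fun _ _ => by ring
    rw [h2, sum_sigma_sigma]
    split_ifs with h
    · congr 1; field_simp
    · simp
  simp only [this, Finset.sum_ite_eq, Finset.mem_univ, if_true]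

lemma sum_sigma_smul_up (k : ℕ) (i : BitPair (k + 1)) (c : ℝ) :
    ∑ g, sigmaSign k g i • c • davieUp (k + 1) g = 0 := by
  simp only [davieUp, Finset.smul_sum, smul_smul]
  rw [Finset.sum_comm]
  refine Finset.sum_eq_zero fun j _ => ?_
  rw [← Finset.sum_smul]
  have h2 : ∀ e : ℝ, ∑ g, sigmaSign k g i * (c * (e * tauSign (k + 1) g j)) =
      (c * e) * ∑ g, sigmaSign k g i * tauSign (k + 1) g j := by
    intro e
    rw [Finset.mul_sum]; exact Finset.sum_congr rfl fun _ _ => by ring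
  rw [h2, sum_sigma_tau, mul_zero, zero_smul]

lemma sum_tau_smul_down (k : ℕ) (i : BitPair (k + 2)) (c : ℝ) :
    ∑ g, tauSign (k + 1) g i • c • davieDown k g = 0 := by
  simp only [davieDown, Finset.smul_sum, smul_smul]
  rw [Finset.sum_comm]
  refine Finset.sum_eq_zero fun j _ => ?_
  rw [← Finset.sum_smul]
  have h2 : ∀ e : ℝ, ∑ g, tauSign (k + 1) g i * (c * (e * sigmaSign k g j)) =
      (c * e) * ∑ g, sigmaSign k g j * tauSign (k + 1) g i := by
    intro e
    rw [Finset.mul_sum]; exact Finset.sum_congr rfl fun _ _ => by ring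
  rw [h2, sum_sigma_tau, mul_zero, zero_smul]

lemma linearCombination_davieVec (k : ℕ) (j : BitPair (k + 1)) :
    Finsupp.linearCombination ℝ davieRow (davieVec k j) = 0 := by
  simp only [davieVec, map_add, map_sum, Finsupp.linearCombination_single]
  have h1 : ∑ g, tauSign k g j • davieRow ⟨k, g⟩ =
      (Fintype.card (BitPair (k + 1)) : ℝ)⁻¹ • davieVec k j := by
    rw [← sum_tau_smul_up]
    cases k with
    | zero => rfl
    | succ k =>
      simp only [davieRow, smul_sub, Finset.sum_sub_distrib]
      rw [sum_tau_smul_down, sub_zero]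
  have h2 : ∑ g, sigmaSign k g j • davieRow ⟨k + 1, g⟩ =
      -((Fintype.card (BitPair (k + 1)) : ℝ)⁻¹ • davieVec k j) := by
    simp only [davieRow, smul_sub, Finset.sum_sub_distrib]
    rw [sum_sigma_smul_up, sum_sigma_smul_down, zero_sub]
  rw [h1, h2, add_neg_cancel]

lemma linearCombination_davieRow (g : DaviePoint) :
    Finsupp.linearCombination ℝ davieRow (davieRow g) = 0 := by
  have hup : ∀ k g, Finsupp.linearCombination ℝ davieRow (davieUp k g) = 0 := fun k g => by
    simp [davieUp, linearCombination_davieVec]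
  have hdown : ∀ k g, Finsupp.linearCombination ℝ davieRow (davieDown k g) = 0 := fun k g => by
    simp [davieDown, linearCombination_davieVec]
  obtain ⟨_ | k, g⟩ := g <;> simp [davieRow, hup, hdown]

lemma davieUp_apply (k : ℕ) (g : Freq (k + 1)) (h : DaviePoint) :
    davieUp k g h = (Fintype.card (BitPair (k + 1)) : ℝ)⁻¹ * ∑ j, tauSign k g j * davieVec k j h := by
  simp [davieUp]

lemma davieDown_apply (k : ℕ) (g : Freq (k + 2)) (h : DaviePoint) :
    davieDown k g h =
      (Fintype.card (BitPair (k + 1)) : ℝ)⁻¹ * ∑ j, sigmaSign k g j * davieVec k j h := by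
  simp [davieDown]

lemma card_bitPair (k : ℕ) : (Fintype.card (BitPair k) : ℝ) = 2 ^ k * 2 ^ k := by simp

lemma card_freq (k : ℕ) : Fintype.card (Freq (k + 1)) = 8 * 4 ^ k := by
  rw [show (4 : ℕ) = 2 * 2 by norm_num, mul_pow]
  simp [pow_succ]; ring

lemma inv_card_mul_abs_le (k : ℕ) {s : ℝ} (hs : |s| ≤ 16 * 2 ^ (k + 1)) :
    |(Fintype.card (BitPair (k + 1)) : ℝ)⁻¹ * s| ≤ 16 * (1 / 2) ^ (k + 1) := by
  rw [card_bitPair, abs_mul, abs_of_pos (by positivity)]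
  calc ((2 : ℝ) ^ (k + 1) * 2 ^ (k + 1))⁻¹ * |s|
      ≤ (2 ^ (k + 1) * 2 ^ (k + 1))⁻¹ * (16 * 2 ^ (k + 1)) := by gcongr
    _ = 16 * (1 / 2) ^ (k + 1) := by rw [one_div, inv_pow]; field_simp

lemma davieUp_apply_self (k : ℕ) (g : Freq (k + 1)) : davieUp k g ⟨k, g⟩ = 1 := by
  simp only [davieUp_apply, davieVec_apply_self, sum_tau_mul_tau]
  exact inv_mul_cancel₀ (by positivity)

lemma davieDown_apply_self (k : ℕ) (g : Freq (k + 2)) : davieDown k g ⟨k + 1, g⟩ = 1 := by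
  simp only [davieDown_apply, davieVec_apply_succ, sum_sigma_mul_sigma]
  exact inv_mul_cancel₀ (by positivity)

lemma abs_davieUp_le (k : ℕ) (g : Freq (k + 1)) (h : DaviePoint) (hgh : h ≠ ⟨k, g⟩) :
    |davieUp k g h| ≤ 16 * (1 / 2) ^ (k + 1) := by
  rw [davieUp_apply]
  apply inv_card_mul_abs_le
  by_cases h1 : h.1 = k
  · obtain ⟨l, h⟩ := h
    obtain rfl : l = k := h1
    simp only [davieVec_apply_self]
    exact abs_sum_tau_tau_le _ fun e => hgh (by rw [e])
  by_cases h2 : h.1 = k + 1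
  · obtain ⟨l, h⟩ := h
    obtain rfl : l = k + 1 := h2
    simp only [davieVec_apply_succ]
    exact abs_sum_tau_sigma_le _ _ _
  simp only [davieVec_apply_of_ne _ h1 h2, mul_zero, Finset.sum_const_zero, abs_zero]
  positivity

lemma abs_davieDown_le (k : ℕ) (g : Freq (k + 2)) (h : DaviePoint) (hgh : h ≠ ⟨k + 1, g⟩) :
    |davieDown k g h| ≤ 16 * (1 / 2) ^ (k + 1) := by
  rw [davieDown_apply]
  apply inv_card_mul_abs_le
  by_cases h1 : h.1 = k
  · obtain ⟨l, h⟩ := h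
    obtain rfl : l = k := h1
    simp only [davieVec_apply_self, mul_comm (sigmaSign _ _ _)]
    exact abs_sum_tau_sigma_le _ _ _
  by_cases h2 : h.1 = k + 1
  · obtain ⟨l, h⟩ := h
    obtain rfl : l = k + 1 := h2
    simp only [davieVec_apply_succ]
    exact abs_sum_sigma_sigma_le _ fun e => hgh (by rw [e])
  simp only [davieVec_apply_of_ne _ h1 h2, mul_zero, Finset.sum_const_zero, abs_zero]
  positivity

lemma davieRow_apply_self_of_ne {g : DaviePoint} (hg : g.1 ≠ 0) : davieRow g g = 0 := by
  obtain ⟨_ | k, g⟩ := g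
  · exact absurd rfl hg
  · simp [davieRow, davieUp_apply_self, davieDown_apply_self]

lemma abs_davieRow_le (g h : DaviePoint) : |davieRow g h| ≤ 16 * (1 / 8) ^ g.1 := by
  have hcard : ∀ k, ((Fintype.card (Freq (k + 1)) : ℝ))⁻¹ = 1 / 8 * (1 / 4) ^ k := fun k => by
    rw [card_freq]; push_cast; rw [mul_inv, one_div_pow]; norm_num
  by_cases hgh : h = g
  · subst hgh
    by_cases h0 : h.1 = 0
    · obtain ⟨k, h⟩ := h
      obtain rfl : k = 0 := h0
      simp only [davieRow, Finsupp.smul_apply, davieUp_apply_self, smul_eq_mul, mul_one]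
      rw [hcard]; norm_num
    · rw [davieRow_apply_self_of_ne h0, abs_zero]; positivity
  obtain ⟨_ | k, g⟩ := g
  · simp only [davieRow, Finsupp.smul_apply, smul_eq_mul]
    rw [hcard, abs_mul]
    have := abs_davieUp_le 0 g h hgh
    norm_num at this ⊢
    linarith
  · simp only [davieRow, Finsupp.smul_apply, Finsupp.sub_apply, smul_eq_mul]
    rw [hcard (k + 1), abs_mul, abs_of_pos (by positivity)]
    have h1 := abs_davieUp_le (k + 1) g h hgh
    have h2 := abs_davieDown_le k g h hgh
    have h3 : |davieUp (k + 1) g h - davieDown k g h| ≤ 24 * (1 / 2) ^ (k + 1) := by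
      refine (abs_sub _ _).trans ?_
      rw [pow_succ _ (k + 1)] at h1
      linarith
    have e : ((1 : ℝ) / 8) ^ (k + 1) = (1 / 4) ^ (k + 1) * (1 / 2) ^ (k + 1) := by
      rw [← mul_pow]; norm_num
    rw [e]
    have hpos : (0 : ℝ) < (1 / 4) ^ (k + 1) := by positivity
    have hpos2 : (0 : ℝ) < (1 / 2) ^ (k + 1) := by positivity
    calc 1 / 8 * (1 / 4 : ℝ) ^ (k + 1) * |davieUp (k + 1) g h - davieDown k g h|
        ≤ 1 / 8 * (1 / 4 : ℝ) ^ (k + 1) * (24 * (1 / 2) ^ (k + 1)) := by gcongr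
      _ ≤ _ := by nlinarith [mul_pos hpos hpos2]

lemma davieRow_zero_apply_self (g : Freq 1) :
    davieRow ⟨0, g⟩ ⟨0, g⟩ = (Fintype.card (Freq 1) : ℝ)⁻¹ := by
  simp only [davieRow, Finsupp.smul_apply, davieUp_apply_self, smul_eq_mul, mul_one]

lemma hasSum_davieRow_self : HasSum (fun g => davieRow g g) 1 := by
  let e : Freq 1 ↪ DaviePoint := Function.Embedding.sigmaMk (β := fun k => Freq (k + 1)) 0
  have h := hasSum_sum_of_ne_finset_zero (f := fun g : DaviePoint => davieRow g g)
    (s := Finset.univ.map e) (L := SummationFilter.unconditional _) ?_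
  · convert h
    rw [Finset.sum_map]
    refine Eq.trans ?_ (Finset.sum_congr rfl fun g _ => (davieRow_zero_apply_self g).symm)
    rw [Finset.sum_const, nsmul_eq_mul, Finset.card_univ]
    exact (mul_inv_cancel₀ (by positivity)).symm
  · rintro ⟨k, g⟩ hg
    refine davieRow_apply_self_of_ne fun h0 => hg ?_
    obtain rfl : k = 0 := h0
    exact Finset.mem_map_of_mem e (Finset.mem_univ g)

lemma det_add_vecMulVec {ι R : Type*} [Fintype ι] [DecidableEq ι] [CommRing R] (M : Matrix ι ι R)
    (w v : ι → R) : (M + Matrix.vecMulVec (M.mulVec w) v).det = M.det * (1 + v ⬝ᵥ w) := by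
  have h : M + Matrix.vecMulVec (M.mulVec w) v =
      M * (1 + Matrix.replicateCol Unit w * Matrix.replicateRow Unit v) := by
    rw [mul_add, mul_one, ← Matrix.vecMulVec_eq, Matrix.mul_vecMulVec]
  rw [h, Matrix.det_mul, Matrix.det_one_add_replicateCol_mul_replicateRow]

section Projection

variable {𝕜 X : Type*} [RCLike 𝕜] [NormedAddCommGroup X] [NormedSpace 𝕜 X]
  {ι : Type*} [Fintype ι]

/-- A regularised moment matrix `M` of finitely many functionals, together with the map `U`
sending a vector to the corresponding average of points of the unit ball. -/
structure IsDesign (f : ι → X →L[𝕜] 𝕜) (c : ℝ) (M : Matrix ι ι 𝕜) (U : (ι → 𝕜) →ₗ[𝕜] X) :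
    Prop where
  pos : 0 < c
  le_form : ∀ v, c * ∑ i, ‖v i‖ ^ 2 ≤ RCLike.re (star v ⬝ᵥ M.mulVec v)
  apply_eq : ∀ v i, f i (U v) = M.mulVec v i - c * v i
  norm_sq_le : ∀ v, ‖U v‖ ^ 2 ≤ RCLike.re (star v ⬝ᵥ M.mulVec v)

namespace IsDesign

variable {f : ι → X →L[𝕜] 𝕜} {c : ℝ} {M : Matrix ι ι 𝕜} {U : (ι → 𝕜) →ₗ[𝕜] X}

lemma re_star_dotProduct_self (v : ι → 𝕜) : RCLike.re (star v ⬝ᵥ v) = ∑ i, ‖v i‖ ^ 2 := by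
  simp only [dotProduct, map_sum, Pi.star_apply, RCLike.star_def, RCLike.conj_mul]
  exact Finset.sum_congr rfl fun i _ => by norm_cast

lemma smul_one [DecidableEq ι] (f : ι → X →L[𝕜] 𝕜) (hc : 0 < c) :
    IsDesign f c ((c : 𝕜) • (1 : Matrix ι ι 𝕜)) 0 where
  pos := hc
  le_form v := by
    rw [Matrix.smul_mulVec, Matrix.one_mulVec, dotProduct_smul, smul_eq_mul, RCLike.re_ofReal_mul,
      re_star_dotProduct_self]
  apply_eq v i := by simp [Matrix.smul_mulVec, RCLike.real_smul_eq_coe_mul]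
  norm_sq_le v := by
    rw [Matrix.smul_mulVec, Matrix.one_mulVec, dotProduct_smul, smul_eq_mul, RCLike.re_ofReal_mul,
      re_star_dotProduct_self]
    simp only [LinearMap.zero_apply, norm_zero, zero_pow two_ne_zero]
    positivity

lemma isUnit [DecidableEq ι] (h : IsDesign f c M U) : IsUnit M := by
  rw [← Matrix.mulVec_injective_iff_isUnit, ← Matrix.coe_mulVecLin, ← LinearMap.ker_eq_bot,
    LinearMap.ker_eq_bot']
  intro v hv
  have h1 := h.le_form v
  rw [Matrix.mulVecLin_apply] at hv
  rw [hv, dotProduct_zero, map_zero] at h1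
  have h2 : ∑ i, ‖v i‖ ^ 2 ≤ 0 := by
    by_contra! h3
    exact absurd h1 (not_le.2 (mul_pos h.pos h3))
  have h3 := (Finset.sum_eq_zero_iff_of_nonneg fun i _ => sq_nonneg ‖v i‖).1
    (le_antisymm h2 (Finset.sum_nonneg fun i _ => sq_nonneg _))
  ext i
  simpa using h3 i (Finset.mem_univ i)

/-- The linear map `v ↦ ⟨q, v⟩ x`. -/
def rankOneMap (q : ι → 𝕜) (x : X) : (ι → 𝕜) →ₗ[𝕜] X where
  toFun v := (star q ⬝ᵥ v) • x
  map_add' v w := by rw [dotProduct_add, add_smul]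
  map_smul' a v := by rw [dotProduct_smul, smul_eq_mul, mul_smul, RingHom.id_apply]

lemma update (h : IsDesign f c M U) {x : X} (hx : ‖x‖ ≤ 1) {t : ℝ} (ht0 : 0 ≤ t) (ht1 : t < 1) :
    IsDesign f ((1 - t) * c)
      (((1 - t : ℝ) : 𝕜) • M + (t : 𝕜) • Matrix.vecMulVec (fun i => f i x) (star fun i => f i x))
      (((1 - t : ℝ) : 𝕜) • U + (t : 𝕜) • rankOneMap (fun i => f i x) x) := by
  set q : ι → 𝕜 := fun i => f i x
  have hmul : ∀ v, (((1 - t : ℝ) : 𝕜) • M + (t : 𝕜) • Matrix.vecMulVec q (star q)).mulVec v =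
      ((1 - t : ℝ) : 𝕜) • M.mulVec v + (t : 𝕜) • (star q ⬝ᵥ v) • q := by
    intro v
    rw [Matrix.add_mulVec, Matrix.smul_mulVec, Matrix.smul_mulVec, Matrix.vecMulVec_mulVec,
      op_smul_eq_smul]
  have hform : ∀ v, RCLike.re (star v ⬝ᵥ
      (((1 - t : ℝ) : 𝕜) • M + (t : 𝕜) • Matrix.vecMulVec q (star q)).mulVec v) =
      (1 - t) * RCLike.re (star v ⬝ᵥ M.mulVec v) + t * ‖star q ⬝ᵥ v‖ ^ 2 := by
    intro v
    have hs : star v ⬝ᵥ q = star (star q ⬝ᵥ v) := by rw [Matrix.star_dotProduct]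
    rw [hmul, dotProduct_add, dotProduct_smul, dotProduct_smul, dotProduct_smul, map_add,
      smul_eq_mul, smul_eq_mul, smul_eq_mul, RCLike.re_ofReal_mul, RCLike.re_ofReal_mul, hs,
      RCLike.star_def, RCLike.mul_conj]
    norm_cast
  refine ⟨mul_pos (by linarith) h.pos, fun v => ?_, fun v i => ?_, fun v => ?_⟩
  · rw [hform, mul_assoc]
    have := mul_le_mul_of_nonneg_left (h.le_form v) (by linarith : 0 ≤ 1 - t)
    have : 0 ≤ t * ‖star q ⬝ᵥ v‖ ^ 2 := by positivity
    linarith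
  · rw [hmul]
    simp only [LinearMap.add_apply, LinearMap.smul_apply, map_add, map_smul, h.apply_eq,
      rankOneMap, LinearMap.coe_mk, AddHom.coe_mk, Pi.add_apply, Pi.smul_apply, smul_eq_mul]
    push_cast
    ring
  · rw [hform]
    have h1 : ‖(((1 - t : ℝ) : 𝕜) • U + (t : 𝕜) • rankOneMap q x) v‖ ≤
        (1 - t) * ‖U v‖ + t * ‖star q ⬝ᵥ v‖ := by
      simp only [LinearMap.add_apply, LinearMap.smul_apply]
      refine (norm_add_le _ _).trans (add_le_add ?_ ?_)
      · rw [norm_smul, RCLike.norm_ofReal, abs_of_nonneg (by linarith)]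
      · rw [norm_smul, RCLike.norm_ofReal, abs_of_nonneg ht0]
        refine mul_le_mul_of_nonneg_left ?_ ht0
        simp only [rankOneMap, LinearMap.coe_mk, AddHom.coe_mk, norm_smul]
        exact mul_le_of_le_one_right (norm_nonneg _) hx
    have h2 := pow_le_pow_left₀ (norm_nonneg _) h1 2
    have h3 := mul_le_mul_of_nonneg_left (h.norm_sq_le v) (by linarith : 0 ≤ 1 - t)
    nlinarith [mul_nonneg (mul_nonneg ht0 (by linarith : 0 ≤ 1 - t))
      (sq_nonneg (‖U v‖ - ‖star q ⬝ᵥ v‖))]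

lemma norm_det_update [DecidableEq ι] (h : IsDesign f c M U) {x : X} {w : ι → 𝕜}
    (hw : M.mulVec w = fun i => f i x) {t : ℝ} (ht0 : 0 ≤ t) (ht1 : t < 1) :
    (1 - t) ^ Fintype.card ι * ‖M.det‖ *
        (1 + t * RCLike.re (star w ⬝ᵥ M.mulVec w)) ≤
      ‖(((1 - t : ℝ) : 𝕜) • M +
        (t : 𝕜) • Matrix.vecMulVec (fun i => f i x) (star fun i => f i x)).det‖ := by
  set q : ι → 𝕜 := fun i => f i x
  have h0 : (0 : ℝ) < 1 - t := by linarith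
  have h0' : ((1 - t : ℝ) : 𝕜) ≠ 0 := by exact_mod_cast h0.ne'
  set s : ℝ := t / (1 - t) with hs
  have hst : t ≤ s := by
    rw [hs, le_div_iff₀ h0]; nlinarith
  have e : ((1 - t : ℝ) : 𝕜) • M + (t : 𝕜) • Matrix.vecMulVec q (star q) =
      ((1 - t : ℝ) : 𝕜) • (M + Matrix.vecMulVec (M.mulVec w) ((s : 𝕜) • star q)) := by
    rw [hw, Matrix.vecMulVec_smul, smul_add, smul_smul]
    congr 2
    rw [hs, ← RCLike.ofReal_mul]
    congr 1; field_simp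
  rw [e, Matrix.det_smul, det_add_vecMulVec, norm_mul, norm_mul, norm_pow, RCLike.norm_ofReal,
    abs_of_pos h0, mul_assoc]
  have hr0 : 0 ≤ RCLike.re (star w ⬝ᵥ M.mulVec w) :=
    (mul_nonneg h.pos.le (Finset.sum_nonneg fun i _ => sq_nonneg _)).trans (h.le_form w)
  have hr : RCLike.re (star q ⬝ᵥ w) = RCLike.re (star w ⬝ᵥ M.mulVec w) := by
    rw [hw, Matrix.star_dotProduct, RCLike.star_def, RCLike.conj_re]
  gcongr
  calc 1 + t * RCLike.re (star w ⬝ᵥ M.mulVec w)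
      ≤ 1 + s * RCLike.re (star w ⬝ᵥ M.mulVec w) := by gcongr
    _ = RCLike.re (1 + ((s : 𝕜) • star q) ⬝ᵥ w) := by
        rw [smul_dotProduct, smul_eq_mul, map_add, RCLike.re_ofReal_mul, hr, RCLike.one_re]
    _ ≤ _ := RCLike.re_le_norm _

lemma norm_entry_le [DecidableEq ι] (h : IsDesign f c M U) (hc : c ≤ 1) (i j : ι) :
    ‖M i j‖ ≤ (∑ i, ‖f i‖) * (∑ i, ‖f i‖ + 1) + 1 := by
  set K := ∑ i, ‖f i‖
  have hK : ∀ i, ‖f i‖ ≤ K := fun i =>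
    Finset.single_le_sum (f := fun i => ‖f i‖) (fun _ _ => norm_nonneg _) (Finset.mem_univ i)
  have hK0 : 0 ≤ K := (norm_nonneg _).trans (hK i)
  have hM : ∀ i, ‖M i j‖ ≤ K * ‖U (Pi.single j 1)‖ + 1 := by
    intro i
    have h1 := h.apply_eq (Pi.single j 1) i
    rw [Matrix.mulVec_single_one, Matrix.col_apply] at h1
    have h2 : M i j = f i (U (Pi.single j 1)) + c * (Pi.single j 1 : ι → 𝕜) i := by
      rw [h1]; ring
    rw [h2]
    refine (norm_add_le _ _).trans (add_le_add ?_ ?_)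
    · exact ((f i).le_opNorm _).trans (mul_le_mul_of_nonneg_right (hK i) (norm_nonneg _))
    · rw [norm_mul, RCLike.norm_ofReal, abs_of_pos h.pos]
      refine mul_le_one₀ hc (norm_nonneg _) ?_
      by_cases hij : i = j
      · subst hij; simp
      · simp [hij]
  have hU : ‖U (Pi.single j 1)‖ ≤ K + 1 := by
    have h1 := h.norm_sq_le (Pi.single j 1)
    have h2 : star (Pi.single j 1 : ι → 𝕜) = Pi.single j 1 := by
      rw [← Pi.single_star, star_one]
    rw [h2, single_one_dotProduct, Matrix.mulVec_single_one, Matrix.col_apply] at h1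
    have h3 := (h1.trans (RCLike.re_le_norm _)).trans (hM j)
    by_contra! h4
    nlinarith [norm_nonneg (U (Pi.single j 1))]
  exact (hM i).trans (by gcongr)

lemma exists_form_inv_le [Nonempty ι] [DecidableEq ι] (f : ι → X →L[𝕜] 𝕜) {δ : ℝ} (hδ : 0 < δ)
    (hδ1 : δ ≤ 1) :
    ∃ c M U, c ≤ δ ∧ IsDesign f c M U ∧ ∀ x w, ‖x‖ ≤ 1 → (M.mulVec w = fun i => f i x) →
      RCLike.re (star w ⬝ᵥ M.mulVec w) ≤ 4 * Fintype.card ι := by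
  set D : Set ℝ := {d | ∃ c M U, c ≤ δ ∧ IsDesign f c M U ∧ d = ‖M.det‖} with hD
  have hbdd : BddAbove D := by
    refine ⟨(Fintype.card ι).factorial •
      ((∑ i, ‖f i‖) * (∑ i, ‖f i‖ + 1) + 1) ^ Fintype.card ι, ?_⟩
    rintro _ ⟨c, M, U, hc, h, rfl⟩
    exact Matrix.det_le (abv := NormedField.toAbsoluteValue 𝕜)
      fun i j => h.norm_entry_le (hc.trans hδ1) i j
  have hpos : ∀ {c M U}, IsDesign f c M U → 0 < ‖M.det‖ := fun h =>
    norm_pos_iff.2 ((Matrix.isUnit_iff_isUnit_det _).1 h.isUnit).ne_zero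
  have hmem : ‖((δ : 𝕜) • (1 : Matrix ι ι 𝕜)).det‖ ∈ D := ⟨δ, _, 0, le_rfl, smul_one f hδ, rfl⟩
  have hsup : 0 < sSup D := (hpos (smul_one f hδ)).trans_le (le_csSup hbdd hmem)
  obtain ⟨_, ⟨c, M, U, hc, h, rfl⟩, hlt⟩ :=
    exists_lt_of_lt_csSup ⟨_, hmem⟩ (by linarith : 2 / 3 * sSup D < sSup D)
  refine ⟨c, M, U, hc, h, fun x w hx hw => ?_⟩
  have hN : (1 : ℝ) ≤ Fintype.card ι := by exact_mod_cast Fintype.card_pos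
  set N : ℝ := (Fintype.card ι : ℝ) with hNdef
  set r := RCLike.re (star w ⬝ᵥ M.mulVec w)
  have ht0 : 0 ≤ 1 / (2 * N) := by positivity
  have ht1 : 1 / (2 * N) < 1 := by rw [div_lt_one (by positivity)]; linarith
  have hr0 : 0 ≤ r :=
    (mul_nonneg h.pos.le (Finset.sum_nonneg fun i _ => sq_nonneg _)).trans (h.le_form w)
  have h1 := h.norm_det_update hw ht0 ht1
  have h2 := le_csSup hbdd ⟨_, _, _, ?_, h.update hx ht0 ht1, rfl⟩
  swap
  · refine le_trans ?_ hc
    nlinarith [mul_nonneg ht0 h.pos.le]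
  have h3 : 1 / 2 ≤ (1 - 1 / (2 * N)) ^ Fintype.card ι := by
    have := one_add_mul_le_pow (a := -(1 / (2 * N))) (by linarith) (Fintype.card ι)
    refine le_trans (le_of_eq ?_) this
    change _ = 1 + N * _
    field_simp
    norm_num
  have h4 : 1 / 2 * ‖M.det‖ * (1 + 1 / (2 * N) * r) < 3 / 2 * ‖M.det‖ := by
    calc 1 / 2 * ‖M.det‖ * (1 + 1 / (2 * N) * r)
        ≤ (1 - 1 / (2 * N)) ^ Fintype.card ι * ‖M.det‖ * (1 + 1 / (2 * N) * r) := by gcongr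
      _ ≤ sSup D := h1.trans h2
      _ < _ := by linarith
  have h5 : 1 / (2 * N) * r < 2 := by
    by_contra! h6
    nlinarith [hpos h]
  rw [one_div, inv_mul_lt_iff₀ (by positivity)] at h5
  linarith

end IsDesign

/-- The span of the rank-one operators. -/
def rankOneSpan (𝕜 X : Type*) [RCLike 𝕜] [NormedAddCommGroup X] [NormedSpace 𝕜 X] :
    Submodule 𝕜 (X →L[𝕜] X) :=
  Submodule.span 𝕜 {T | ∃ (f : X →L[𝕜] 𝕜) (y : X), T = f.smulRight y}

lemma smulRight_mem_rankOneSpan (f : X →L[𝕜] 𝕜) (y : X) : f.smulRight y ∈ rankOneSpan 𝕜 X :=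
  Submodule.subset_span ⟨f, y, rfl⟩

lemma mul_mem_rankOneSpan (T : X →L[𝕜] X) {R : X →L[𝕜] X} (hR : R ∈ rankOneSpan 𝕜 X) :
    T * R ∈ rankOneSpan 𝕜 X := by
  induction hR using Submodule.span_induction with
  | mem R hR =>
    obtain ⟨f, y, rfl⟩ := hR
    convert smulRight_mem_rankOneSpan f (T y) using 1
    ext x; simp
  | zero => simp
  | add R R' _ _ h h' => rw [mul_add]; exact add_mem h h'
  | smul a R _ h => rw [mul_smul_comm]; exact Submodule.smul_mem _ _ h

lemma le_mul_norm_of_unit_ball {g : X → ℝ} (hg : ∀ (a : 𝕜) x, g (a • x) = ‖a‖ * g x) {C : ℝ}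
    (hC : ∀ x, ‖x‖ ≤ 1 → g x ≤ C) (x : X) : g x ≤ C * ‖x‖ := by
  by_cases hx : x = 0
  · subst hx
    have := hg 0 0
    rw [norm_zero, zero_mul, smul_zero] at this
    simp [this]
  have hx' : 0 < ‖x‖ := norm_pos_iff.2 hx
  have hn : ‖((‖x‖⁻¹ : ℝ) : 𝕜)‖ = ‖x‖⁻¹ := by
    rw [RCLike.norm_ofReal, abs_of_pos (inv_pos.2 hx')]
  have h := hC (((‖x‖⁻¹ : ℝ) : 𝕜) • x) (by rw [norm_smul, hn, inv_mul_cancel₀ hx'.ne'])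
  rwa [hg, hn, inv_mul_le_iff₀ hx', mul_comm] at h

/-- Finitely many functionals are almost preserved by a finite-rank operator whose norm is of the
order of the square root of their number. -/
lemma exists_rankOneSpan_approx (f : ι → X →L[𝕜] 𝕜) {η : ℝ} (hη : 0 < η) :
    ∃ P ∈ rankOneSpan 𝕜 X, (∀ x, ‖P x‖ ≤ 2 * √(Fintype.card ι) * ‖x‖) ∧
      ∀ x, ∑ i, ‖f i (x - P x)‖ ≤ η * ‖x‖ := by
  classical
  cases isEmpty_or_nonempty ι
  · exact ⟨0, zero_mem _, by simp, fun x => by simpa using by positivity⟩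
  have hN : (1 : ℝ) ≤ Fintype.card ι := by exact_mod_cast Fintype.card_pos
  set N : ℝ := (Fintype.card ι : ℝ) with hNdef
  obtain ⟨c, M, U, hc, h, hr⟩ := IsDesign.exists_form_inv_le f
    (δ := min 1 ((η / (2 * N)) ^ 2)) (by positivity) (min_le_left _ _)
  have hdet : IsUnit M.det := (Matrix.isUnit_iff_isUnit_det _).1 h.isUnit
  let P : X →L[𝕜] X := ∑ i, (∑ j, M⁻¹ i j • f j).smulRight (U (Pi.single i 1))
  have hP : ∀ x, P x = U (M⁻¹.mulVec fun i => f i x) := by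
    intro x
    conv_rhs => rw [← Finset.univ_sum_single (M⁻¹.mulVec fun i => f i x), map_sum]
    simp only [P, sum_apply, ContinuousLinearMap.smulRight_apply,
      smul_apply, smul_eq_mul]
    refine Finset.sum_congr rfl fun i _ => ?_
    rw [← map_smul, ← Pi.single_smul, smul_eq_mul, mul_one]
    rfl
  have hw : ∀ x, M.mulVec (M⁻¹.mulVec fun i => f i x) = fun i => f i x := fun x => by
    rw [Matrix.mulVec_mulVec, Matrix.mul_nonsing_inv _ hdet, Matrix.one_mulVec]
  have hP1 : ∀ x, ‖x‖ ≤ 1 → ‖P x‖ ≤ 2 * √N := by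
    intro x hx
    refine (sq_le_sq₀ (norm_nonneg _) (by positivity)).1 ?_
    rw [hP, mul_pow, Real.sq_sqrt (by positivity)]
    exact (h.norm_sq_le _).trans ((hr x _ hx (hw x)).trans (by rw [hNdef]; norm_num))
  have hf1 : ∀ x, ‖x‖ ≤ 1 → ∑ i, ‖f i (x - P x)‖ ≤ η := by
    intro x hx
    have h1 : ∀ i, ‖f i (x - P x)‖ = c * ‖(M⁻¹.mulVec fun i => f i x) i‖ := by
      intro i
      rw [map_sub, hP, h.apply_eq, hw, sub_sub_cancel, norm_mul, RCLike.norm_ofReal,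
        abs_of_pos h.pos]
    simp only [h1]
    set w := M⁻¹.mulVec fun i => f i x
    have h2 := (h.le_form w).trans (hr x w hx (hw x))
    rw [← Finset.mul_sum]
    refine (sq_le_sq₀ (mul_nonneg h.pos.le (Finset.sum_nonneg fun _ _ => norm_nonneg _))
      hη.le).1 ?_
    have h3 : (∑ i, ‖w i‖) ^ 2 ≤ N * ∑ i, ‖w i‖ ^ 2 := by
      simpa [N] using sq_sum_le_card_mul_sum_sq (s := Finset.univ) (f := fun i => ‖w i‖)
    calc (c * ∑ i, ‖w i‖) ^ 2 ≤ c ^ 2 * (N * ∑ i, ‖w i‖ ^ 2) := by rw [mul_pow]; gcongr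
      _ = c * N * (c * ∑ i, ‖w i‖ ^ 2) := by ring
      _ ≤ (η / (2 * N)) ^ 2 * N * (4 * N) := by
        have := h.pos.le
        gcongr
        exact hc.trans (min_le_right _ _)
      _ = η ^ 2 := by field_simp; norm_num
  refine ⟨P, Submodule.sum_mem _ fun i _ => smulRight_mem_rankOneSpan _ _, fun x => ?_, fun x => ?_⟩
  · exact le_mul_norm_of_unit_ball (𝕜 := 𝕜) (fun a x => by rw [map_smul, norm_smul]) hP1 x
  · refine le_mul_norm_of_unit_ball (𝕜 := 𝕜) (g := fun x => ∑ i, ‖f i (x - P x)‖) (fun a x => ?_) hf1 x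
    simp only [map_smul, ← smul_sub, norm_smul, Finset.mul_sum]

end Projection

section GelfandClass

variable {𝕜 X : Type*} [RCLike 𝕜] [NormedAddCommGroup X] [NormedSpace 𝕜 X]

variable (𝕜 X) in
/-- Operators whose restrictions to subspaces of codimension of order `4 ^ l` have norm of order
`ρ ^ (k * l)`. -/
def gelfandClass (ρ : ℝ) (k : ℕ) : Submodule 𝕜 (X →L[𝕜] X) where
  carrier := {T | ∃ C : ℝ, 0 ≤ C ∧ ∃ m : ℕ, ∀ l : ℕ, ∃ (ι : Type) (_ : Fintype ι)
    (f : ι → X →L[𝕜] 𝕜), Fintype.card ι ≤ m * 4 ^ l ∧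
      ∀ x, ‖T x‖ ≤ C * ρ ^ (k * l) * ‖x‖ + ∑ i, ‖f i x‖}
  zero_mem' := ⟨0, le_rfl, 0, fun l => ⟨Empty, inferInstance, fun i => i.elim, by simp, by simp⟩⟩
  add_mem' := by
    rintro T T' ⟨C, hC, m, h⟩ ⟨C', hC', m', h'⟩
    refine ⟨C + C', add_nonneg hC hC', m + m', fun l => ?_⟩
    obtain ⟨ι, _, f, hf, hT⟩ := h l
    obtain ⟨ι', _, f', hf', hT'⟩ := h' l
    refine ⟨ι ⊕ ι', inferInstance, Sum.elim f f', ?_, fun x => ?_⟩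
    · rw [Fintype.card_sum, add_mul]; exact add_le_add hf hf'
    · rw [Fintype.sum_sum_type]
      refine (norm_add_le _ _).trans ((add_le_add (hT x) (hT' x)).trans (le_of_eq ?_))
      simp only [Sum.elim_inl, Sum.elim_inr]
      ring
  smul_mem' := by
    rintro a T ⟨C, hC, m, h⟩
    refine ⟨‖a‖ * C, mul_nonneg (norm_nonneg _) hC, m, fun l => ?_⟩
    obtain ⟨ι, _, f, hf, hT⟩ := h l
    refine ⟨ι, inferInstance, fun i => a • f i, hf, fun x => ?_⟩
    simp only [smul_apply, norm_smul]
    rw [← Finset.mul_sum]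
    exact (mul_le_mul_of_nonneg_left (hT x) (norm_nonneg a)).trans (le_of_eq (by ring))

lemma gelfandClass_zero (ρ : ℝ) : gelfandClass 𝕜 X ρ 0 = ⊤ := by
  refine eq_top_iff.2 fun T _ => ⟨‖T‖, norm_nonneg _, 0, fun l =>
    ⟨Empty, inferInstance, fun i => i.elim, by simp, fun x => ?_⟩⟩
  simpa using T.le_opNorm x

lemma gelfandClass_antitone {ρ : ℝ} (h0 : 0 ≤ ρ) (h1 : ρ ≤ 1) :
    Antitone (gelfandClass 𝕜 X ρ) := by
  rintro k k' hk T ⟨C, hC, m, h⟩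
  refine ⟨C, hC, m, fun l => ?_⟩
  obtain ⟨ι, _, f, hf, hT⟩ := h l
  refine ⟨ι, inferInstance, f, hf, fun x => (hT x).trans ?_⟩
  have : ρ ^ (k' * l) ≤ ρ ^ (k * l) := pow_le_pow_of_le_one h0 h1 (by gcongr)
  gcongr

lemma mul_mem_gelfandClass {ρ : ℝ} (h0 : 0 ≤ ρ) {k k' : ℕ} {T T' : X →L[𝕜] X}
    (hT : T ∈ gelfandClass 𝕜 X ρ k) (hT' : T' ∈ gelfandClass 𝕜 X ρ k') :
    T * T' ∈ gelfandClass 𝕜 X ρ (k + k') := by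
  obtain ⟨C, hC, m, h⟩ := hT
  obtain ⟨C', hC', m', h'⟩ := hT'
  refine ⟨C * C', mul_nonneg hC hC', m + m', fun l => ?_⟩
  obtain ⟨ι, _, f, hf, hT⟩ := h l
  obtain ⟨ι', _, f', hf', hT'⟩ := h' l
  refine ⟨ι ⊕ ι', inferInstance,
    Sum.elim (fun i => (f i).comp T') fun i => ((C * ρ ^ (k * l) : ℝ) : 𝕜) • f' i, ?_,
    fun x => ?_⟩
  · rw [Fintype.card_sum, add_mul]; exact add_le_add hf hf'
  · have hnn : 0 ≤ C * ρ ^ (k * l) := by positivity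
    rw [Fintype.sum_sum_type]
    simp only [Sum.elim_inl, Sum.elim_inr, ContinuousLinearMap.comp_apply, smul_apply, norm_smul,
      RCLike.norm_ofReal, abs_of_nonneg hnn, mul_apply_eq_comp]
    rw [← Finset.mul_sum]
    refine (hT _).trans ?_
    have := mul_le_mul_of_nonneg_left (hT' x) hnn
    rw [add_mul, pow_add]
    linarith

lemma gelfandClass_le_closure {ρ : ℝ} (h0 : 0 ≤ ρ) {k : ℕ} (hk : 2 * ρ ^ k < 1) :
    (gelfandClass 𝕜 X ρ k : Set (X →L[𝕜] X)) ⊆ closure (rankOneSpan 𝕜 X) := by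
  rintro T ⟨C, hC, m, h⟩
  rw [Metric.mem_closure_iff]
  intro ε hε
  have hlim : Tendsto (fun l : ℕ => C * (ρ ^ k) ^ l + 2 * √m * C * (2 * ρ ^ k) ^ l) atTop
      (𝓝 (C * 0 + 2 * √m * C * 0)) := by
    have h0k : 0 ≤ ρ ^ k := by positivity
    exact ((tendsto_pow_atTop_nhds_zero_of_lt_one h0k (by linarith)).const_mul _).add
      ((tendsto_pow_atTop_nhds_zero_of_lt_one (by positivity) hk).const_mul _)
  obtain ⟨l, hl⟩ := (hlim.eventually (gt_mem_nhds (show _ < ε / 2 by simpa using hε))).exists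
  obtain ⟨ι, _, f, hf, hT⟩ := h l
  obtain ⟨P, hP, hP1, hP2⟩ := exists_rankOneSpan_approx f (η := ε / 4) (by positivity)
  refine ⟨T * P, mul_mem_rankOneSpan T hP, ?_⟩
  have hcard : √(Fintype.card ι) ≤ √m * 2 ^ l := by
    rw [← Real.sqrt_sq (show (0 : ℝ) ≤ 2 ^ l by positivity), ← Real.sqrt_mul (by positivity)]
    refine Real.sqrt_le_sqrt ?_
    calc (Fintype.card ι : ℝ) ≤ (m * 4 ^ l : ℕ) := by exact_mod_cast hf
      _ = m * (2 ^ l) ^ 2 := by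
        push_cast; rw [← pow_mul, mul_comm l 2, pow_mul]; norm_num
  rw [dist_eq_norm]
  refine lt_of_le_of_lt (ContinuousLinearMap.opNorm_le_bound _ (M := ε / 2 + ε / 4)
    (by positivity) fun x => ?_) (by linarith)
  have e : (T - T * P) x = T (x - P x) := by simp
  rw [e]
  have h1 : ‖x - P x‖ ≤ (1 + 2 * (√m * 2 ^ l)) * ‖x‖ := by
    refine (norm_sub_le _ _).trans ?_
    have := (hP1 x).trans (mul_le_mul_of_nonneg_right
      (mul_le_mul_of_nonneg_left hcard zero_le_two) (norm_nonneg x))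
    linarith
  calc ‖T (x - P x)‖ ≤ C * ρ ^ (k * l) * ‖x - P x‖ + ∑ i, ‖f i (x - P x)‖ := hT _
    _ ≤ C * ρ ^ (k * l) * ((1 + 2 * (√m * 2 ^ l)) * ‖x‖) + ε / 4 * ‖x‖ := by
      gcongr
      exact hP2 x
    _ = (C * (ρ ^ k) ^ l + 2 * √m * C * (2 * ρ ^ k) ^ l + ε / 4) * ‖x‖ := by
      rw [mul_pow, pow_mul]; ring
    _ ≤ (ε / 2 + ε / 4) * ‖x‖ := by gcongr

end GelfandClass

section QuasiNuclear

variable {𝕜 X : Type*} [RCLike 𝕜] [NormedAddCommGroup X] [NormedSpace 𝕜 X]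

lemma IsQuasiPNuclear.of_countable {ι : Type*} [Countable ι] {p : ℝ} (hp : 0 < p)
    {T : X →L[𝕜] X} (f : ι → X →L[𝕜] 𝕜) (hf : Summable fun i => ‖f i‖ ^ p)
    (hT : ∀ x, ‖T x‖ ≤ (∑' i, ‖f i x‖ ^ p) ^ (1 / p)) : IsQuasiPNuclear p T := by
  obtain ⟨e, he⟩ := exists_injective_nat ι
  have hout : ∀ k ∉ Set.range e, Function.extend e f 0 k = 0 := fun k hk => by
    rw [Function.extend_apply' _ _ _ hk]; rfl
  refine ⟨Function.extend e f 0, ?_, fun x => (hT x).trans (le_of_eq ?_)⟩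
  · rw [← he.summable_iff fun k hk => by rw [hout k hk, norm_zero, Real.zero_rpow hp.ne']]
    simpa only [Function.comp_def, he.extend_apply] using hf
  · congr 1
    rw [← he.tsum_eq (f := fun k => ‖Function.extend e f 0 k x‖ ^ p)]
    · simp only [he.extend_apply]
    · intro k hk
      by_contra h
      exact hk (by simp only [hout k h, zero_apply, norm_zero, Real.zero_rpow hp.ne'])

lemma summable_norm_apply_rpow {ι : Type*} {p : ℝ} (hp : 0 < p) {f : ι → X →L[𝕜] 𝕜}
    (hf : Summable fun i => ‖f i‖ ^ p) (x : X) : Summable fun i => ‖f i x‖ ^ p := by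
  refine Summable.of_nonneg_of_le (fun i => by positivity) (fun i => ?_) (hf.mul_right (‖x‖ ^ p))
  rw [← Real.mul_rpow (norm_nonneg _) (norm_nonneg _)]
  exact Real.rpow_le_rpow (norm_nonneg _) ((f i).le_opNorm x) hp.le

lemma le_tsum_rpow {ι : Type*} {p : ℝ} (hp : 0 < p) {a : ι → ℝ} (ha : ∀ i, 0 ≤ a i)
    (hs : Summable fun i => a i ^ p) (i : ι) : a i ≤ (∑' i, a i ^ p) ^ (1 / p) := by
  rw [one_div, Real.le_rpow_inv_iff_of_pos (ha i) (tsum_nonneg fun i => Real.rpow_nonneg (ha i) p) hp]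
  exact hs.le_tsum i fun j _ => Real.rpow_nonneg (ha j) p

lemma IsQuasiPNuclear.mul_left {p : ℝ} (hp : 0 < p) (R : X →L[𝕜] X) {T : X →L[𝕜] X}
    (hT : IsQuasiPNuclear p T) : IsQuasiPNuclear p (R * T) := by
  obtain ⟨f, hf, hT⟩ := hT
  have hn : ∀ z : 𝕜, ‖((‖R‖ : ℝ) : 𝕜) * z‖ = ‖R‖ * ‖z‖ := fun z => by simp
  refine ⟨fun k => ((‖R‖ : ℝ) : 𝕜) • f k, ?_, fun x => ?_⟩
  · simp only [norm_smul, RCLike.norm_ofReal, abs_norm]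
    simpa only [Real.mul_rpow (norm_nonneg R) (norm_nonneg _)] using hf.mul_left _
  · simp only [smul_apply, smul_eq_mul, hn, Real.mul_rpow (norm_nonneg R) (norm_nonneg _)]
    rw [tsum_mul_left, Real.mul_rpow (by positivity) (tsum_nonneg fun _ => by positivity),
      ← Real.rpow_mul (norm_nonneg R), mul_one_div_cancel hp.ne', Real.rpow_one]
    exact (R.le_opNorm _).trans (mul_le_mul_of_nonneg_left (hT x) (norm_nonneg R))

lemma IsQuasiPNuclear.add {p : ℝ} (hp : 0 < p) {T T' : X →L[𝕜] X}
    (hT : IsQuasiPNuclear p T) (hT' : IsQuasiPNuclear p T') : IsQuasiPNuclear p (T + T') := by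
  obtain ⟨f, hf, hT⟩ := hT
  obtain ⟨f', hf', hT'⟩ := hT'
  have h2 : ∀ (g : ℕ → X →L[𝕜] 𝕜), (Summable fun k => ‖g k‖ ^ p) →
      Summable fun k => ‖(2 : 𝕜) • g k‖ ^ p := by
    intro g hg
    simp only [norm_smul, RCLike.norm_ofNat, Real.mul_rpow zero_le_two (norm_nonneg _)]
    exact hg.mul_left _
  have hval : ∀ (g : ℕ → X →L[𝕜] 𝕜) x, ∑' k, ‖((2 : 𝕜) • g k) x‖ ^ p =
      2 ^ p * ∑' k, ‖g k x‖ ^ p := by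
    intro g x
    simp only [smul_apply, norm_smul, RCLike.norm_ofNat,
      Real.mul_rpow zero_le_two (norm_nonneg _), tsum_mul_left]
  let F : ℕ ⊕ ℕ → X →L[𝕜] 𝕜 := Sum.elim (fun k => (2 : 𝕜) • f k) fun k => (2 : 𝕜) • f' k
  have hF : Summable fun i => ‖F i‖ ^ p := by
    refine Summable.sum (fun i => ‖F i‖ ^ p) ?_ ?_
    · exact h2 f hf
    · exact h2 f' hf'
  refine IsQuasiPNuclear.of_countable hp F hF fun x => ?_
  have hsum : ∑' i, ‖F i x‖ ^ p =
      ∑' k, ‖((2 : 𝕜) • f k) x‖ ^ p + ∑' k, ‖((2 : 𝕜) • f' k) x‖ ^ p :=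
    Summable.tsum_sum (summable_norm_apply_rpow hp (h2 f hf) x)
      (summable_norm_apply_rpow hp (h2 f' hf') x)
  rw [hsum, hval, hval]
  set a := ∑' k, ‖f k x‖ ^ p
  set b := ∑' k, ‖f' k x‖ ^ p
  have ha : 0 ≤ a := tsum_nonneg fun _ => by positivity
  have hb : 0 ≤ b := tsum_nonneg fun _ => by positivity
  have key : ∀ c d : ℝ, 0 ≤ c → 0 ≤ d → 2 * c ^ (1 / p) ≤ (2 ^ p * c + 2 ^ p * d) ^ (1 / p) := by
    intro c d hc hd
    calc 2 * c ^ (1 / p) = (2 ^ p * c) ^ (1 / p) := by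
          rw [Real.mul_rpow (by positivity) hc, ← Real.rpow_mul zero_le_two,
            mul_one_div_cancel hp.ne', Real.rpow_one]
      _ ≤ _ := by
        have : 0 ≤ (2 : ℝ) ^ p * d := by positivity
        gcongr
        linarith
  have h3 := key a b ha hb
  have h4 := key b a hb ha
  rw [add_comm (2 ^ p * b)] at h4
  have h5 : ‖(T + T') x‖ ≤ ‖T x‖ + ‖T' x‖ := norm_add_le _ _
  linarith [hT x, hT' x]

lemma isQuasiPNuclear_of_mem_rankOneSpan {p : ℝ} (hp : 0 < p) {T : X →L[𝕜] X}
    (hT : T ∈ rankOneSpan 𝕜 X) : IsQuasiPNuclear p T := by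
  induction hT using Submodule.span_induction with
  | mem R hR =>
    obtain ⟨f, y, rfl⟩ := hR
    refine IsQuasiPNuclear.of_countable hp (ι := Unit) (fun _ => ((‖y‖ : ℝ) : 𝕜) • f)
      (Summable.of_finite) fun x => ?_
    simp only [tsum_fintype, Finset.univ_unique, Finset.sum_singleton]
    rw [← Real.rpow_mul (norm_nonneg _), mul_one_div_cancel hp.ne', Real.rpow_one]
    simp [norm_smul, mul_comm]
  | zero =>
    refine ⟨0, ?_, fun x => ?_⟩
    · simp [Real.zero_rpow hp.ne', summable_zero]
    · simpa [Real.zero_rpow hp.ne'] using Real.rpow_nonneg le_rfl _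
  | add R R' _ _ h h' => exact h.add hp h'
  | smul a R _ h =>
    have : a • R = (a • (1 : X →L[𝕜] X)) * R := by simp
    rw [this]
    exact h.mul_left hp _

lemma mem_rankOneSpan_of_mem_finRankOps {T : X →L[𝕜] X} (hT : T ∈ finRankOps 𝕜 X X) :
    T ∈ rankOneSpan 𝕜 X := by
  have hfd : FiniteDimensional 𝕜 (LinearMap.range (T : X →ₗ[𝕜] X)) := hT
  let b := Module.finBasis 𝕜 (LinearMap.range (T : X →ₗ[𝕜] X))
  let T' : X →L[𝕜] LinearMap.range (T : X →ₗ[𝕜] X) := T.codRestrict _ fun x => ⟨x, rfl⟩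
  have h : T = ∑ i, ((b.coord i).toContinuousLinearMap.comp T').smulRight (b i : X) := by
    ext x
    have h1 := congrArg Subtype.val (b.sum_repr (T' x))
    simp only [Submodule.coe_sum, Submodule.coe_smul] at h1
    simp only [sum_apply, ContinuousLinearMap.smulRight_apply, ContinuousLinearMap.comp_apply]
    exact h1.symm
  rw [h]
  exact Submodule.sum_mem _ fun i _ => smulRight_mem_rankOneSpan _ _

end QuasiNuclear

section Subideal

variable {𝕜 X : Type*} [RCLike 𝕜] [NormedAddCommGroup X] [NormedSpace 𝕜 X]

/-- The span of the positive powers of an operator. -/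
def positivePowerSpan (S : X →L[𝕜] X) : Submodule 𝕜 (X →L[𝕜] X) :=
  Submodule.span 𝕜 (Set.range fun j : ℕ => S ^ (j + 1))

lemma mul_mem_positivePowerSpan {S A B : X →L[𝕜] X} (hA : A ∈ positivePowerSpan S)
    (hB : B ∈ positivePowerSpan S) : A * B ∈ positivePowerSpan S := by
  induction hA, hB using Submodule.span_induction₂ with
  | mem_mem A B hA hB =>
    obtain ⟨i, rfl⟩ := hA
    obtain ⟨j, rfl⟩ := hB
    refine Submodule.subset_span ⟨i + 1 + j, ?_⟩
    change S ^ (i + 1 + j + 1) = S ^ (i + 1) * S ^ (j + 1)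
    rw [← pow_add, add_assoc (i + 1)]
  | zero_left => simp
  | zero_right => simp
  | add_left A A' B _ _ _ h h' => rw [add_mul]; exact add_mem h h'
  | add_right A B B' _ _ _ h h' => rw [mul_add]; exact add_mem h h'
  | smul_left r A B _ _ h => rw [smul_mul_assoc]; exact Submodule.smul_mem _ _ h
  | smul_right r A B _ _ h => rw [mul_smul_comm]; exact Submodule.smul_mem _ _ h

lemma positivePowerSpan_le_gelfandClass {ρ : ℝ} (h0 : 0 ≤ ρ) {S : X →L[𝕜] X}
    (hS : S ∈ gelfandClass 𝕜 X ρ 1) : positivePowerSpan S ≤ gelfandClass 𝕜 X ρ 1 := by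
  refine Submodule.span_le.2 ?_
  rintro _ ⟨j, rfl⟩
  change S ^ (j + 1) ∈ _
  rw [pow_succ]
  exact mul_mem_gelfandClass h0 (k := 0) (by rw [gelfandClass_zero]; trivial) hS

lemma mul_mem_sup_gelfandClass {ρ : ℝ} (h0 : 0 ≤ ρ) (h1 : ρ ≤ 1) {S : X →L[𝕜] X}
    (hS : S ∈ gelfandClass 𝕜 X ρ 1) {k k' : ℕ} (hk : k ≤ k') (hk' : k' ≤ k + 1)
    {A B : X →L[𝕜] X} (hA : A ∈ positivePowerSpan S ⊔ gelfandClass 𝕜 X ρ k)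
    (hB : B ∈ positivePowerSpan S ⊔ gelfandClass 𝕜 X ρ k') :
    A * B ∈ positivePowerSpan S ⊔ gelfandClass 𝕜 X ρ k' ∧
      B * A ∈ positivePowerSpan S ⊔ gelfandClass 𝕜 X ρ k' := by
  obtain ⟨a, ha, u, hu, rfl⟩ := Submodule.mem_sup.1 hA
  obtain ⟨b, hb, v, hv, rfl⟩ := Submodule.mem_sup.1 hB
  have hle := positivePowerSpan_le_gelfandClass h0 hS
  have hanti := fun {l l'} (h : l ≤ l') => gelfandClass_antitone (𝕜 := 𝕜) (X := X) h0 h1 h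
  constructor
  · rw [add_mul, mul_add, mul_add, add_assoc]
    refine Submodule.add_mem_sup (mul_mem_positivePowerSpan ha hb)
      (add_mem ?_ (add_mem ?_ ?_))
    · exact hanti (by omega) (mul_mem_gelfandClass h0 (hle ha) hv)
    · exact hanti (by omega) (mul_mem_gelfandClass h0 hu (hle hb))
    · exact hanti (by omega) (mul_mem_gelfandClass h0 hu hv)
  · rw [add_mul, mul_add, mul_add, add_assoc]
    refine Submodule.add_mem_sup (mul_mem_positivePowerSpan hb ha)
      (add_mem ?_ (add_mem ?_ ?_))
    · exact hanti (by omega) (mul_mem_gelfandClass h0 (hle hb) hu)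
    · exact hanti (by omega) (mul_mem_gelfandClass h0 hv (hle ha))
    · exact hanti (by omega) (mul_mem_gelfandClass h0 hv hu)

/-- The polynomials in `S` without constant term, enlarged by a Gelfand class. -/
def powerSubalgebra {ρ : ℝ} (h0 : 0 ≤ ρ) (h1 : ρ ≤ 1) {S : X →L[𝕜] X}
    (hS : S ∈ gelfandClass 𝕜 X ρ 1) (k : ℕ) : NonUnitalSubalgebra 𝕜 (X →L[𝕜] X) :=
  { positivePowerSpan S ⊔ gelfandClass 𝕜 X ρ k with
    mul_mem' := fun hA hB =>
      (mul_mem_sup_gelfandClass h0 h1 hS le_rfl (Nat.le_succ k) hA hB).1 }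

lemma IsIdealOf.topologicalClosure {J I : NonUnitalSubalgebra 𝕜 (X →L[𝕜] X)}
    (h : IsIdealOf J I) : IsIdealOf J.topologicalClosure I.topologicalClosure :=
  ⟨closure_mono h.1, fun _ ha _ hx =>
    ⟨map_mem_closure₂ continuous_mul ha hx fun a ha x hx => (h.2 a ha x hx).1,
      map_mem_closure₂ (f := fun a x => x * a) (continuous_snd.mul continuous_fst) ha hx
        fun a ha x hx => (h.2 a ha x hx).2⟩⟩

lemma IsQuasiPNuclear.of_mem_positivePowerSpan {p : ℝ} (hp : 0 < p) {S A : X →L[𝕜] X}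
    (hS : IsQuasiPNuclear p S) (hA : A ∈ positivePowerSpan S) : IsQuasiPNuclear p A := by
  obtain ⟨R, rfl⟩ : ∃ R, A = R * S := by
    induction hA using Submodule.span_induction with
    | mem A hA =>
      obtain ⟨j, rfl⟩ := hA
      exact ⟨S ^ j, pow_succ S j⟩
    | zero => exact ⟨0, by simp⟩
    | add A B _ _ h h' =>
      obtain ⟨R, rfl⟩ := h
      obtain ⟨R', rfl⟩ := h'
      exact ⟨R + R', by rw [add_mul]⟩
    | smul r A _ h =>
      obtain ⟨R, rfl⟩ := h
      exact ⟨r • R, by rw [smul_mul_assoc]⟩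
  exact hS.mul_left hp R

/-- A functional vanishing on the finite-rank operators and on the powers of `S` separates an
iterated closed ideal chain of one length from all shorter ones. -/
theorem exists_closed_subideal_of_functional {p ρ : ℝ} (hp : 0 < p) (h0 : 0 ≤ ρ) (h1 : ρ ≤ 1)
    {n : ℕ} (hρ : 2 * ρ ^ (n + 1) < 1) {S T : X →L[𝕜] X} (hS : S ∈ gelfandClass 𝕜 X ρ 1)
    (hSp : IsQuasiPNuclear p S) (Φ : (X →L[𝕜] X) →L[𝕜] 𝕜) (hΦ : ∀ R ∈ rankOneSpan 𝕜 X, Φ R = 0)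
    (hΦS : ∀ j, Φ (S ^ (j + 1)) = 0) (hΦT : Φ (T * S ^ n) ≠ 0) :
    ∃ M : Set (X →L[𝕜] X), M ⊆ closure {T : X →L[𝕜] X | IsQuasiPNuclear p T} ∧
      IsClosedNSubideal 𝕜 (n + 1) M ∧ ¬IsClosedNSubideal 𝕜 n M := by
  let B := powerSubalgebra h0 h1 hS
  have hmem : ∀ {A k}, A ∈ B k ↔ A ∈ positivePowerSpan S ⊔ gelfandClass 𝕜 X ρ k := Iff.rfl
  have hle : (gelfandClass 𝕜 X ρ (n + 1) : Set (X →L[𝕜] X)) ⊆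
      (rankOneSpan 𝕜 X).topologicalClosure := gelfandClass_le_closure h0 hρ
  have hker : ((B (n + 1)).topologicalClosure : Set (X →L[𝕜] X)) ⊆ {A | Φ A = 0} := by
    have hcl : IsClosed {A | Φ A = 0} := isClosed_eq Φ.continuous continuous_const
    refine closure_minimal (fun A hA => ?_) hcl
    obtain ⟨a, ha, u, hu, rfl⟩ := Submodule.mem_sup.1 (hmem.1 hA)
    have ha' : Φ a = 0 := by
      have : positivePowerSpan S ≤ LinearMap.ker (Φ : (X →L[𝕜] X) →ₗ[𝕜] 𝕜) := by
        refine Submodule.span_le.2 ?_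
        rintro _ ⟨j, rfl⟩
        exact hΦS j
      exact this ha
    have hu' : Φ u = 0 := closure_minimal (fun R hR => hΦ R hR) hcl (hle hu)
    rw [Set.mem_ofPred_eq, map_add, ha', hu', add_zero]
  refine ⟨((B (n + 1)).topologicalClosure : Set (X →L[𝕜] X)), ?_,
    ⟨fun k => (B k).topologicalClosure, ?_, rfl, fun k _ => isClosed_closure, fun k _ => ?_⟩, ?_⟩
  · refine closure_minimal (fun A hA => ?_) isClosed_closure
    obtain ⟨a, ha, u, hu, rfl⟩ := Submodule.mem_sup.1 (hmem.1 hA)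
    refine map_mem_closure (f := fun v => a + v) (continuous_const.add continuous_id)
      (hle hu) fun R hR => ?_
    exact (hSp.of_mem_positivePowerSpan hp ha).add hp (isQuasiPNuclear_of_mem_rankOneSpan hp hR)
  · refine Set.eq_univ_of_forall fun A => subset_closure (hmem.2 ?_)
    rw [gelfandClass_zero]
    exact Submodule.mem_sup_right trivial
  · refine IsIdealOf.topologicalClosure ⟨fun A hA => ?_, fun A hA A' hA' => ?_⟩
    · have h := gelfandClass_antitone (𝕜 := 𝕜) (X := X) h0 h1 (Nat.le_succ k)
      exact sup_le_sup (le_refl (positivePowerSpan S)) h hA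
    · exact mul_mem_sup_gelfandClass h0 h1 hS (Nat.le_succ k) le_rfl hA hA'
  · rintro ⟨C, hC0, hCn, -, hC⟩
    have hanti : ∀ k ≤ n, (C n : Set (X →L[𝕜] X)) ⊆ C k := fun k hk => by
      induction hk using Nat.decreasingInduction with
      | self => exact subset_rfl
      | of_succ k hk ih => exact ih.trans (hC k hk).1
    have hSn : S ∈ (C n : Set (X →L[𝕜] X)) := by
      rw [hCn]
      refine subset_closure (hmem.2 (Submodule.mem_sup_left (Submodule.subset_span ⟨0, ?_⟩)))
      simp
    have hTS : ∀ k ≤ n, T * S ^ k ∈ C k := by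
      intro k
      induction k with
      | zero =>
        intro _
        rw [← SetLike.mem_coe, hC0]
        trivial
      | succ k ih =>
        intro hk
        rw [pow_succ, ← mul_assoc]
        exact ((hC k hk).2 _ (ih (by omega)) S (hanti (k + 1) hk hSn)).1
    have : T * S ^ n ∈ (C n : Set (X →L[𝕜] X)) := hTS n le_rfl
    rw [hCn] at this
    exact hΦT (hker this)

end Subideal

section Model

/-- A square-zero matrix of trace one with rapidly decreasing rows, indexed by a graded set of
exponential growth, together with a weight `ρ` and a number of layers. -/
structure SquareZeroModel (G : Type) where
  /-- the grading -/
  level : G → ℕ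
  /-- the rows of the matrix -/
  row : G → G →₀ ℝ
  /-- the weight -/
  ρ : ℝ
  /-- the index of the last layer -/
  last : ℕ
  abs_row_le : ∀ g h, |row g h| ≤ 16 * (1 / 8) ^ level g
  linearCombination_row : ∀ g, Finsupp.linearCombination ℝ row (row g) = 0
  hasSum_diag : HasSum (fun g => row g g) 1
  summable_pow : ∀ x : ℝ, 0 ≤ x → 4 * x < 1 → Summable fun g => x ^ level g
  finite_lt : ∀ l, Finite {h // level h < l}
  card_lt_le : ∀ l, Nat.card {h // level h < l} ≤ 8 * 4 ^ l
  ρ_pos : 0 < ρ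
  ρ_le_one : ρ ≤ 1
  half_lt : 1 / 2 < ρ ^ last

lemma exists_hasSum_apply {𝕜 E G : Type*} [RCLike 𝕜] [NormedAddCommGroup E] [NormedSpace 𝕜 E]
    (F : G → E →L[𝕜] 𝕜) (hF : Summable fun g => ‖F g‖) :
    ∃ Φ : E →L[𝕜] 𝕜, ∀ x, HasSum (fun g => F g x) (Φ x) :=
  ⟨∑' g, F g, fun x => (ContinuousLinearMap.apply 𝕜 𝕜 x).hasSum hF.of_norm.hasSum⟩

namespace SquareZeroModel

lemma ρ_pow_le_one {G : Type} (D : SquareZeroModel G) (k : ℕ) : D.ρ ^ k ≤ 1 :=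
  pow_le_one₀ D.ρ_pos.le D.ρ_le_one

lemma half_lt_pow {G : Type} (D : SquareZeroModel G) {m : ℕ} (hm : m ≤ D.last) : 1 / 2 < D.ρ ^ m :=
  D.half_lt.trans_le (pow_le_pow_of_le_one D.ρ_pos.le D.ρ_le_one hm)

lemma summable_weight {G : Type} (D : SquareZeroModel G) {m : ℕ} (hm : m ≤ D.last) :
    Summable fun g => (D.ρ ^ (m * D.level g))⁻¹ * (16 * (1 / 8) ^ D.level g) := by
  have h0 := D.half_lt_pow hm
  have hpos : 0 < D.ρ ^ m := lt_trans (by norm_num) h0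
  have : 4 * ((D.ρ ^ m)⁻¹ * (1 / 8)) < 1 := by
    have : (D.ρ ^ m)⁻¹ < 2 := by
      rw [inv_lt_comm₀ hpos (by norm_num)]; linarith
    linarith
  refine ((D.summable_pow _ (by positivity) this).mul_left 16).congr fun g => ?_
  rw [mul_pow, inv_pow, pow_mul]
  ring

lemma hasSum_diag_ofReal {G : Type} (D : SquareZeroModel G) (𝕜 : Type) [RCLike 𝕜] :
     HasSum (fun g => (D.row g g : 𝕜)) 1 := by
  simpa using (RCLike.hasSum_ofReal 𝕜).2 D.hasSum_diag

variable {G : Type} (D : SquareZeroModel G) [TopologicalSpace G] [DiscreteTopology G]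
  (𝕜 : Type) [RCLike 𝕜]

/-- The generators of the space. -/
def gen (b : Bool) (s : ℕ) (g : G) : BoundedContinuousFunction (Bool × ℕ × G) 𝕜 :=
  .ofNormedAddCommGroupDiscrete
    (fun γ => if γ.1 = b ∧ γ.2.1 = s ∧ s ≤ D.last then
      ((D.ρ ^ (s * D.level γ.2.2) * D.row g γ.2.2 : ℝ) : 𝕜) else 0)
    (16 * (1 / 8) ^ D.level g) fun γ => by
      split_ifs
      · rw [RCLike.norm_ofReal, abs_mul, abs_of_nonneg (pow_nonneg D.ρ_pos.le _)]
        exact (mul_le_of_le_one_left (abs_nonneg _) (D.ρ_pow_le_one _)).trans (D.abs_row_le _ _)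
      · rw [norm_zero]; positivity

lemma gen_apply (b : Bool) (s : ℕ) (g : G) (γ : Bool × ℕ × G) :
    D.gen 𝕜 b s g γ = if γ.1 = b ∧ γ.2.1 = s ∧ s ≤ D.last then
      ((D.ρ ^ (s * D.level γ.2.2) * D.row g γ.2.2 : ℝ) : 𝕜) else 0 := rfl

lemma norm_gen_le (b : Bool) (s : ℕ) (g : G) : ‖D.gen 𝕜 b s g‖ ≤ 16 * (1 / 8) ^ D.level g := by
  unfold gen
  exact BoundedContinuousFunction.norm_ofNormedAddCommGroup_le _ (by positivity) _

/-- The space spanned by the generators. -/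
def space : Submodule 𝕜 (BoundedContinuousFunction (Bool × ℕ × G) 𝕜) :=
  (Submodule.span 𝕜 {x | ∃ b s g, x = D.gen 𝕜 b s g}).topologicalClosure

lemma gen_mem (b : Bool) (s : ℕ) (g : G) : D.gen 𝕜 b s g ∈ D.space 𝕜 :=
  Submodule.le_topologicalClosure _ (Submodule.subset_span ⟨b, s, g, rfl⟩)

lemma isClosed_space : IsClosed (D.space 𝕜 : Set (BoundedContinuousFunction (Bool × ℕ × G) 𝕜)) :=
  Submodule.isClosed_topologicalClosure _

lemma space_le {W : Submodule 𝕜 (BoundedContinuousFunction (Bool × ℕ × G) 𝕜)}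
    (hW : IsClosed (W : Set (BoundedContinuousFunction (Bool × ℕ × G) 𝕜)))
    (h : ∀ b s g, D.gen 𝕜 b s g ∈ W) : D.space 𝕜 ≤ W := by
  refine Submodule.topologicalClosure_minimal _ (Submodule.span_le.2 ?_) hW
  rintro _ ⟨b, s, g, rfl⟩
  exact h b s g

/-- The space as a type, to keep its instances opaque. -/
def Carrier : Type := D.space 𝕜

instance : NormedAddCommGroup (D.Carrier 𝕜) := inferInstanceAs (NormedAddCommGroup (D.space 𝕜))

instance : NormedSpace 𝕜 (D.Carrier 𝕜) := inferInstanceAs (NormedSpace 𝕜 (D.space 𝕜))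

/-- The inclusion of the space into the bounded functions. -/
def incl : D.Carrier 𝕜 →ₗᵢ[𝕜] BoundedContinuousFunction (Bool × ℕ × G) 𝕜 := (D.space 𝕜).subtypeₗᵢ

lemma incl_mem (x : D.Carrier 𝕜) : D.incl 𝕜 x ∈ D.space 𝕜 :=
  Subtype.property (p := (· ∈ D.space 𝕜)) x

lemma isClosed_range_incl : IsClosed (Set.range (D.incl 𝕜)) := by
  have : Set.range (D.incl 𝕜) = (D.space 𝕜 : Set _) := Subtype.range_coe
  rw [this]
  exact D.isClosed_space 𝕜

/-- The generators as elements of the space. -/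
def vec (b : Bool) (s : ℕ) (g : G) : D.Carrier 𝕜 :=
  (⟨D.gen 𝕜 b s g, D.gen_mem 𝕜 b s g⟩ : D.space 𝕜)

lemma norm_vec_le (b : Bool) (s : ℕ) (g : G) : ‖D.vec 𝕜 b s g‖ ≤ 16 * (1 / 8) ^ D.level g :=
  D.norm_gen_le 𝕜 b s g

/-- A continuous linear map preserving the span of the generators acts on the space. -/
def restrict (L : BoundedContinuousFunction (Bool × ℕ × G) 𝕜 →L[𝕜]
    BoundedContinuousFunction (Bool × ℕ × G) 𝕜)
    (h : ∀ b s g, L (D.gen 𝕜 b s g) ∈ D.space 𝕜) : D.Carrier 𝕜 →L[𝕜] D.Carrier 𝕜 :=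
  (L.comp (D.incl 𝕜).toContinuousLinearMap).codRestrict (D.space 𝕜) fun x => by
    have : D.space 𝕜 ≤ (D.space 𝕜).comap (L : _ →ₗ[𝕜] _) :=
      D.space_le 𝕜 ((D.isClosed_space 𝕜).preimage L.continuous) h
    exact this (D.incl_mem 𝕜 x)

/-- Weighted composition operators. -/
def weightedComp (c : Bool × ℕ × G → ℝ) (hc : ∀ γ, |c γ| ≤ 1) (r : Bool × ℕ × G → Bool × ℕ × G) :
    BoundedContinuousFunction (Bool × ℕ × G) 𝕜 →L[𝕜] BoundedContinuousFunction (Bool × ℕ × G) 𝕜 :=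
  have hb : ∀ (x : BoundedContinuousFunction (Bool × ℕ × G) 𝕜) γ,
      ‖(c γ : 𝕜) * x (r γ)‖ ≤ ‖x‖ := fun x γ => by
    rw [norm_mul, RCLike.norm_ofReal]
    exact (mul_le_of_le_one_left (norm_nonneg _) (hc γ)).trans (x.norm_coe_le_norm _)
  LinearMap.mkContinuous
    { toFun := fun x => .ofNormedAddCommGroupDiscrete (fun γ => (c γ : 𝕜) * x (r γ)) ‖x‖ (hb x)
      map_add' := fun x y => by ext γ; exact mul_add _ _ _
      map_smul' := fun a x => by ext γ; exact mul_left_comm _ _ _ }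
    1 fun x => by
      rw [one_mul]
      exact BoundedContinuousFunction.norm_ofNormedAddCommGroup_le _ (norm_nonneg _) (hb x)

@[simp] lemma weightedComp_apply (c : Bool × ℕ × G → ℝ) (hc : ∀ γ, |c γ| ≤ 1)
    (r : Bool × ℕ × G → Bool × ℕ × G) (x : BoundedContinuousFunction (Bool × ℕ × G) 𝕜)
    (γ : Bool × ℕ × G) : weightedComp 𝕜 c hc r x γ = (c γ : 𝕜) * x (r γ) := rfl

/-- The weighted shift between layers. -/
def shiftAux : BoundedContinuousFunction (Bool × ℕ × G) 𝕜 →L[𝕜]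
    BoundedContinuousFunction (Bool × ℕ × G) 𝕜 :=
  weightedComp 𝕜 (fun γ => if 1 ≤ γ.2.1 ∧ γ.2.1 ≤ D.last then D.ρ ^ D.level γ.2.2 else 0)
    (fun γ => by
      split_ifs
      · rw [abs_of_nonneg (pow_nonneg D.ρ_pos.le _)]; exact D.ρ_pow_le_one _
      · simp)
    fun γ => (γ.1, γ.2.1 - 1, γ.2.2)

lemma shiftAux_apply (x : BoundedContinuousFunction (Bool × ℕ × G) 𝕜) (γ : Bool × ℕ × G) :
    D.shiftAux 𝕜 x γ =
      ((if 1 ≤ γ.2.1 ∧ γ.2.1 ≤ D.last then D.ρ ^ D.level γ.2.2 else 0 : ℝ) : 𝕜) *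
        x (γ.1, γ.2.1 - 1, γ.2.2) := rfl

lemma shiftAux_gen (b : Bool) (s : ℕ) (g : G) :
    D.shiftAux 𝕜 (D.gen 𝕜 b s g) = D.gen 𝕜 b (s + 1) g := by
  ext ⟨b', t, h⟩
  simp only [shiftAux_apply, gen_apply]
  by_cases hb : b' = b
  swap
  · simp [hb]
  by_cases ht : t = s + 1
  · subst ht
    by_cases hs : s + 1 ≤ D.last
    · have hs' : s ≤ D.last := by omega
      simp only [hb, hs, hs', Nat.add_sub_cancel, Nat.le_add_left, and_self, if_true]
      rw [← RCLike.ofReal_mul]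
      congr 1
      ring
    · simp [hs]
  · have : ¬(1 ≤ t ∧ t ≤ D.last ∧ t - 1 = s) := by omega
    by_cases h1 : 1 ≤ t ∧ t ≤ D.last
    · have h2 : t - 1 ≠ s := by omega
      simp [h2, ht]
    · simp [h1, ht]

/-- The weighted shift on the space. -/
def shift : D.Carrier 𝕜 →L[𝕜] D.Carrier 𝕜 :=
  D.restrict 𝕜 (D.shiftAux 𝕜) fun b s g => by rw [shiftAux_gen]; exact D.gen_mem 𝕜 _ _ _

lemma shift_pow_vec (b : Bool) (j : ℕ) (g : G) :
    (D.shift 𝕜 ^ j) (D.vec 𝕜 b 0 g) = D.vec 𝕜 b j g := by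
  induction j with
  | zero => rfl
  | succ j ih =>
    rw [pow_succ', mul_apply_eq_comp, ih]
    exact (D.incl 𝕜).injective (D.shiftAux_gen 𝕜 b j g)

/-- The projection onto the first half of the coordinates. -/
def projAux : BoundedContinuousFunction (Bool × ℕ × G) 𝕜 →L[𝕜]
    BoundedContinuousFunction (Bool × ℕ × G) 𝕜 :=
  weightedComp 𝕜 (fun γ => if γ.1 = true then 1 else 0) (fun γ => by split_ifs <;> simp) id

lemma projAux_gen (b : Bool) (s : ℕ) (g : G) :
    projAux 𝕜 (D.gen 𝕜 b s g) = if b = true then D.gen 𝕜 b s g else 0 := by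
  ext ⟨b', t, h⟩
  have : projAux 𝕜 (D.gen 𝕜 b s g) (b', t, h) =
    ((if b' = true then 1 else 0 : ℝ) : 𝕜) * D.gen 𝕜 b s g (b', t, h) := rfl
  rw [this, gen_apply]
  cases b <;> cases b' <;> simp [gen_apply]

/-- The projection onto the first half of the space. -/
def proj : D.Carrier 𝕜 →L[𝕜] D.Carrier 𝕜 :=
  D.restrict 𝕜 (projAux 𝕜) fun b s g => by
    rw [projAux_gen]
    split_ifs
    · exact D.gen_mem 𝕜 _ _ _
    · exact zero_mem _

lemma proj_vec (b : Bool) (s : ℕ) (g : G) :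
    D.proj 𝕜 (D.vec 𝕜 b s g) = if b = true then D.vec 𝕜 b s g else 0 := by
  refine (D.incl 𝕜).injective ((D.projAux_gen 𝕜 b s g).trans ?_)
  split_ifs <;> rfl

/-- Evaluation at a coordinate. -/
def coord (γ : Bool × ℕ × G) : D.Carrier 𝕜 →L[𝕜] 𝕜 :=
  (BoundedContinuousFunction.evalCLM 𝕜 γ).comp (D.incl 𝕜).toContinuousLinearMap

lemma coord_apply (γ : Bool × ℕ × G) (x : D.Carrier 𝕜) : D.coord 𝕜 γ x = D.incl 𝕜 x γ := rfl

lemma norm_coord_apply_le (γ : Bool × ℕ × G) (x : D.Carrier 𝕜) : ‖D.coord 𝕜 γ x‖ ≤ ‖x‖ := by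
  rw [← (D.incl 𝕜).norm_map]
  exact (D.incl 𝕜 x).norm_coe_le_norm γ

lemma norm_le_of_coord (x : D.Carrier 𝕜) {r : ℝ} (hr : 0 ≤ r) (h : ∀ γ, ‖D.coord 𝕜 γ x‖ ≤ r) :
    ‖x‖ ≤ r := by
  rw [← (D.incl 𝕜).norm_map]
  exact (BoundedContinuousFunction.norm_le hr).2 h

lemma coord_vec (b : Bool) (s : ℕ) (g : G) (γ : Bool × ℕ × G) :
    D.coord 𝕜 γ (D.vec 𝕜 b s g) = if γ.1 = b ∧ γ.2.1 = s ∧ s ≤ D.last then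
      ((D.ρ ^ (s * D.level γ.2.2) * D.row g γ.2.2 : ℝ) : 𝕜) else 0 := rfl

lemma coord_shift (γ : Bool × ℕ × G) (x : D.Carrier 𝕜) :
    D.coord 𝕜 γ (D.shift 𝕜 x) =
      ((if 1 ≤ γ.2.1 ∧ γ.2.1 ≤ D.last then D.ρ ^ D.level γ.2.2 else 0 : ℝ) : 𝕜) *
        D.coord 𝕜 (γ.1, γ.2.1 - 1, γ.2.2) x := rfl

lemma sum_row_smul_vec (b : Bool) (g : G) :
    ((D.row g).sum fun h r => (r : 𝕜) • D.vec 𝕜 b 0 h) = 0 := by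
  refine (D.incl 𝕜).injective ?_
  rw [map_zero]
  ext γ
  rw [← coord_apply]
  have h1 : D.coord 𝕜 γ ((D.row g).sum fun h r => (r : 𝕜) • D.vec 𝕜 b 0 h) =
      (D.row g).sum fun h r => (r : 𝕜) * D.coord 𝕜 γ (D.vec 𝕜 b 0 h) := by
    rw [Finsupp.sum, map_sum]
    exact Finset.sum_congr rfl fun h _ => by rw [map_smul, smul_eq_mul]
  have h2 : ((D.row g).sum fun h r => r * D.row h γ.2.2) = 0 := by
    have := DFunLike.congr_fun (D.linearCombination_row g) γ.2.2
    rw [Finsupp.linearCombination_apply, Finsupp.sum, Finsupp.finsetSum_apply] at this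
    exact this
  rw [h1]
  simp only [coord_vec]
  by_cases hγ : γ.1 = b ∧ γ.2.1 = 0
  · simp only [hγ, Nat.zero_le, and_self, if_true, zero_mul, pow_zero, one_mul]
    have := congr_arg (fun x : ℝ => (x : 𝕜)) h2
    simpa [Finsupp.sum] using this
  · simp [hγ]

/-- The diagonal coefficients of an operator, between two layers. -/
def diagCoeff (b : Bool) (m : ℕ) (g : G) : (D.Carrier 𝕜 →L[𝕜] D.Carrier 𝕜) →L[𝕜] 𝕜 :=
  (((D.ρ ^ (m * D.level g))⁻¹ : ℝ) : 𝕜) •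
    (D.coord 𝕜 (b, m, g)).comp (ContinuousLinearMap.apply 𝕜 (D.Carrier 𝕜) (D.vec 𝕜 b 0 g))

lemma diagCoeff_apply (b : Bool) (m : ℕ) (g : G) (T : D.Carrier 𝕜 →L[𝕜] D.Carrier 𝕜) :
    D.diagCoeff 𝕜 b m g T =
      (((D.ρ ^ (m * D.level g))⁻¹ : ℝ) : 𝕜) * D.coord 𝕜 (b, m, g) (T (D.vec 𝕜 b 0 g)) := rfl

lemma norm_diagCoeff_apply_le (b : Bool) (m : ℕ) (g : G) (T : D.Carrier 𝕜 →L[𝕜] D.Carrier 𝕜) :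
    ‖D.diagCoeff 𝕜 b m g T‖ ≤ (D.ρ ^ (m * D.level g))⁻¹ * ‖T (D.vec 𝕜 b 0 g)‖ := by
  have h0 : 0 ≤ (D.ρ ^ (m * D.level g))⁻¹ := inv_nonneg.2 (pow_nonneg D.ρ_pos.le _)
  rw [diagCoeff_apply, norm_mul, RCLike.norm_ofReal, abs_of_nonneg h0]
  exact mul_le_mul_of_nonneg_left (D.norm_coord_apply_le 𝕜 _ _) h0

lemma summable_norm_diagCoeff (b : Bool) {m : ℕ} (hm : m ≤ D.last) :
    Summable fun g => ‖D.diagCoeff 𝕜 b m g‖ := by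
  refine (D.summable_weight hm).of_nonneg_of_le
    (fun _ => ContinuousLinearMap.opNorm_nonneg _) fun g => ?_
  have h0 : 0 ≤ (D.ρ ^ (m * D.level g))⁻¹ := inv_nonneg.2 (pow_nonneg D.ρ_pos.le _)
  refine ContinuousLinearMap.opNorm_le_bound _ (by positivity) fun T => ?_
  refine (D.norm_diagCoeff_apply_le 𝕜 b m g T).trans ?_
  rw [mul_assoc]
  refine mul_le_mul_of_nonneg_left ?_ h0
  rw [mul_comm]
  exact (T.le_opNorm _).trans (mul_le_mul_of_nonneg_left (D.norm_vec_le 𝕜 b 0 g) (norm_nonneg _))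

/-- The trace-like functional between two layers. -/
def layerTrace (b : Bool) (m : ℕ) (hm : m ≤ D.last) : (D.Carrier 𝕜 →L[𝕜] D.Carrier 𝕜) →L[𝕜] 𝕜 :=
  (exists_hasSum_apply _ (D.summable_norm_diagCoeff 𝕜 b hm)).choose

lemma hasSum_layerTrace (b : Bool) (m : ℕ) (hm : m ≤ D.last) (T : D.Carrier 𝕜 →L[𝕜] D.Carrier 𝕜) :
    HasSum (fun g => D.diagCoeff 𝕜 b m g T) (D.layerTrace 𝕜 b m hm T) :=
  (exists_hasSum_apply _ (D.summable_norm_diagCoeff 𝕜 b hm)).choose_spec T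

lemma layerTrace_smulRight (b : Bool) (m : ℕ) (hm : m ≤ D.last) (f : D.Carrier 𝕜 →L[𝕜] 𝕜)
    (y : D.Carrier 𝕜) : D.layerTrace 𝕜 b m hm (f.smulRight y) = 0 := by
  let w : G → 𝕜 := fun g => (((D.ρ ^ (m * D.level g))⁻¹ : ℝ) : 𝕜) * f (D.vec 𝕜 b 0 g)
  have hw : Summable fun g => ‖w g • BoundedContinuousFunction.evalCLM 𝕜 (β := 𝕜) (b, m, g)‖ := by
    refine ((D.summable_weight hm).mul_left ‖f‖).of_nonneg_of_le (fun _ => norm_nonneg _)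
      fun g => ?_
    have h0 : 0 ≤ (D.ρ ^ (m * D.level g))⁻¹ := inv_nonneg.2 (pow_nonneg D.ρ_pos.le _)
    have h1 : ‖w g‖ ≤ ‖f‖ * ((D.ρ ^ (m * D.level g))⁻¹ * (16 * (1 / 8) ^ D.level g)) := by
      rw [norm_mul, RCLike.norm_ofReal, abs_of_nonneg h0, mul_left_comm]
      exact mul_le_mul_of_nonneg_left ((f.le_opNorm _).trans
        (mul_le_mul_of_nonneg_left (D.norm_vec_le 𝕜 b 0 g) (norm_nonneg _))) h0
    have h2 : ‖BoundedContinuousFunction.evalCLM 𝕜 (β := 𝕜) (b, m, g)‖ ≤ 1 :=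
      ContinuousLinearMap.opNorm_le_bound _ zero_le_one fun x => by
        rw [one_mul]; exact x.norm_coe_le_norm _
    rw [norm_smul]
    exact (mul_le_of_le_one_right (norm_nonneg _) h2).trans h1
  obtain ⟨ψ, hψ⟩ := exists_hasSum_apply _ hw
  have hker : D.space 𝕜 ≤ LinearMap.ker (ψ : _ →ₗ[𝕜] 𝕜) := by
    refine D.space_le 𝕜 ψ.isClosed_ker fun b' s g' => ?_
    refine (hψ (D.gen 𝕜 b' s g')).unique ?_
    have hterm : ∀ g, (w g • BoundedContinuousFunction.evalCLM 𝕜 (β := 𝕜) (b, m, g))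
        (D.gen 𝕜 b' s g') =
        if b = b' ∧ m = s then f ((D.row g' g : 𝕜) • D.vec 𝕜 b 0 g) else 0 := by
      intro g
      have h0 : D.ρ ^ (m * D.level g) ≠ 0 := (pow_pos D.ρ_pos _).ne'
      change w g * D.gen 𝕜 b' s g' (b, m, g) = _
      rw [gen_apply]
      by_cases h : b = b' ∧ m = s
      · obtain ⟨rfl, rfl⟩ := h
        simp only [hm, and_self, if_true, map_smul, smul_eq_mul, w]
        have : ((D.ρ ^ (m * D.level g) : ℝ) : 𝕜) ≠ 0 := by exact_mod_cast h0
        rw [RCLike.ofReal_inv, RCLike.ofReal_mul]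
        field_simp
      · have : ¬(b = b' ∧ m = s ∧ s ≤ D.last) := fun hh => h ⟨hh.1, hh.2.1⟩
        simp [h, this]
    simp only [hterm]
    split_ifs
    · have h1 : (∑ g ∈ (D.row g').support, f ((D.row g' g : 𝕜) • D.vec 𝕜 b 0 g)) = 0 := by
        rw [← map_sum]
        exact (congr_arg f (D.sum_row_smul_vec 𝕜 b g')).trans (map_zero f)
      rw [← h1]
      refine hasSum_sum_of_ne_finset_zero (L := SummationFilter.unconditional _) fun g hg => ?_
      rw [Finsupp.notMem_support_iff.1 hg]
      simp
    · exact hasSum_zero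
  have hy : ψ (D.incl 𝕜 y) = 0 := hker (D.incl_mem 𝕜 y)
  refine (D.hasSum_layerTrace 𝕜 b m hm (f.smulRight y)).unique ?_
  rw [← hy]
  refine (hψ (D.incl 𝕜 y)).congr_fun fun g => ?_
  change _ * D.coord 𝕜 (b, m, g) (f (D.vec 𝕜 b 0 g) • y) = _ * _
  rw [map_smul, smul_eq_mul, ← mul_assoc]
  rfl

lemma layerTrace_of_mem_rankOneSpan (b : Bool) (m : ℕ) (hm : m ≤ D.last)
    {T : D.Carrier 𝕜 →L[𝕜] D.Carrier 𝕜} (hT : T ∈ rankOneSpan 𝕜 (D.Carrier 𝕜)) :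
    D.layerTrace 𝕜 b m hm T = 0 := by
  have : rankOneSpan 𝕜 (D.Carrier 𝕜) ≤ LinearMap.ker (D.layerTrace 𝕜 b m hm : _ →ₗ[𝕜] 𝕜) := by
    refine Submodule.span_le.2 ?_
    rintro _ ⟨f, y, rfl⟩
    exact D.layerTrace_smulRight 𝕜 b m hm f y
  exact this hT

lemma diagCoeff_of_apply_vec (b : Bool) (m : ℕ) (hm : m ≤ D.last) (j : ℕ)
    {T : D.Carrier 𝕜 →L[𝕜] D.Carrier 𝕜} (g : G) (hT : T (D.vec 𝕜 b 0 g) = D.vec 𝕜 b j g) :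
    D.diagCoeff 𝕜 b m g T = if m = j then (D.row g g : 𝕜) else 0 := by
  have h0 : ((D.ρ ^ (m * D.level g) : ℝ) : 𝕜) ≠ 0 := by exact_mod_cast (pow_pos D.ρ_pos _).ne'
  rw [diagCoeff_apply, hT, coord_vec]
  by_cases h : m = j
  · subst h
    simp only [hm, and_self, if_true]
    rw [RCLike.ofReal_inv, RCLike.ofReal_mul, inv_mul_cancel_left₀ h0]
  · simp [h]

lemma layerTrace_shift_pow (b : Bool) (m : ℕ) (hm : m ≤ D.last) (j : ℕ) :
    D.layerTrace 𝕜 b m hm (D.shift 𝕜 ^ j) = if m = j then 1 else 0 := by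
  refine (D.hasSum_layerTrace 𝕜 b m hm _).unique ?_
  simp only [fun g => D.diagCoeff_of_apply_vec 𝕜 b m hm j g (D.shift_pow_vec 𝕜 b j g)]
  split_ifs
  · exact D.hasSum_diag_ofReal 𝕜
  · exact hasSum_zero

lemma layerTrace_proj_mul_shift_pow (b : Bool) :
    D.layerTrace 𝕜 b D.last le_rfl (D.proj 𝕜 * D.shift 𝕜 ^ D.last) =
      if b = true then 1 else 0 := by
  refine (D.hasSum_layerTrace 𝕜 b _ le_rfl _).unique ?_
  have hv : ∀ g, (D.proj 𝕜 * D.shift 𝕜 ^ D.last) (D.vec 𝕜 b 0 g) =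
      if b = true then D.vec 𝕜 b D.last g else 0 := fun g => by
    rw [mul_apply_eq_comp, shift_pow_vec, proj_vec]
  cases b with
  | true =>
    simp only [fun g => D.diagCoeff_of_apply_vec 𝕜 true D.last le_rfl D.last g (hv g), if_true]
    exact D.hasSum_diag_ofReal 𝕜
  | false =>
    have h0 : ∀ g, D.diagCoeff 𝕜 false D.last g (D.proj 𝕜 * D.shift 𝕜 ^ D.last) = 0 := fun g => by
      rw [diagCoeff_apply, hv g]
      simp
    simp only [h0]
    exact hasSum_zero

lemma not_hasApproximationProperty [Countable G] :
    ¬HasApproximationProperty 𝕜 (D.Carrier 𝕜) := by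
  intro hAP
  let z : G → D.Carrier 𝕜 := fun g => ((6 ^ D.level g : ℝ) : 𝕜) • D.vec 𝕜 false 0 g
  have hzn : ∀ g, ‖z g‖ ≤ 16 * (3 / 4) ^ D.level g := fun g => by
    rw [norm_smul, RCLike.norm_ofReal, abs_of_nonneg (by positivity)]
    refine (mul_le_mul_of_nonneg_left (D.norm_vec_le 𝕜 false 0 g) (by positivity)).trans_eq ?_
    rw [mul_left_comm, ← mul_pow]
    norm_num
  have hlevel : Tendsto D.level cofinite atTop := by
    refine tendsto_atTop.2 fun l => ?_
    have h : {h | D.level h < l}.Finite := D.finite_lt l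
    exact h.subset fun g hg => by simpa using hg
  have hz : Tendsto z cofinite (𝓝 0) := by
    refine squeeze_zero_norm hzn ?_
    have := ((tendsto_pow_atTop_nhds_zero_of_lt_one (r := (3 / 4 : ℝ)) (by norm_num)
      (by norm_num)).comp hlevel).const_mul 16
    simpa using this
  have hs : Summable fun g => (1 / 6 : ℝ) ^ D.level g :=
    D.summable_pow _ (by norm_num) (by norm_num)
  set A := ∑' g, (1 / 6 : ℝ) ^ D.level g with hA
  have hA0 : 0 ≤ A := tsum_nonneg fun g => by positivity
  obtain ⟨T, hT, hTz⟩ := hAP _ hz.isCompact_insert_range_of_cofinite (1 / (A + 1)) (by positivity)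
  have h1 : D.layerTrace 𝕜 false 0 (Nat.zero_le _) (1 - T) = 1 := by
    rw [map_sub, D.layerTrace_of_mem_rankOneSpan 𝕜 false 0 _ (mem_rankOneSpan_of_mem_finRankOps hT),
      sub_zero]
    simpa using D.layerTrace_shift_pow 𝕜 false 0 (Nat.zero_le _) 0
  have h2 : ∀ g, ‖D.diagCoeff 𝕜 false 0 g (1 - T)‖ ≤ (1 / (A + 1)) * (1 / 6) ^ D.level g := by
    intro g
    refine (D.norm_diagCoeff_apply_le 𝕜 false 0 g (1 - T)).trans ?_
    have h3 : ‖T (z g) - z g‖ ≤ 1 / (A + 1) := hTz _ (Or.inr ⟨g, rfl⟩)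
    have h4 : T (z g) - z g = -(((6 ^ D.level g : ℝ) : 𝕜) • ((1 - T) (D.vec 𝕜 false 0 g))) := by
      change _ = -(_ • (D.vec 𝕜 false 0 g - T (D.vec 𝕜 false 0 g)))
      rw [smul_sub, ← map_smul, neg_sub]
    rw [h4, norm_neg, norm_smul, RCLike.norm_ofReal, abs_of_nonneg (by positivity)] at h3
    rw [zero_mul, pow_zero, inv_one, one_mul, one_div_pow, mul_one_div, le_div_iff₀ (by positivity),
      mul_comm]
    exact h3
  have h5 := (D.hasSum_layerTrace 𝕜 false 0 (Nat.zero_le _) (1 - T)).norm_le_of_bounded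
    (hs.hasSum.mul_left _) h2
  rw [h1, norm_one, one_div_mul_eq_div, ← hA, le_div_iff₀ (by positivity)] at h5
  linarith

/-- The functionals controlling the shift. -/
def shiftCoord (i : Bool × Fin D.last × G) : D.Carrier 𝕜 →L[𝕜] 𝕜 :=
  D.coord 𝕜 (i.1, i.2.1, i.2.2)

lemma norm_coord_shift_le (γ : Bool × ℕ × G) (x : D.Carrier 𝕜) :
    D.coord 𝕜 γ (D.shift 𝕜 x) = 0 ∨ ∃ i : Bool × Fin D.last × G, i.2.2 = γ.2.2 ∧
      ‖D.coord 𝕜 γ (D.shift 𝕜 x)‖ = D.ρ ^ D.level γ.2.2 * ‖D.shiftCoord 𝕜 i x‖ := by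
  rw [coord_shift]
  by_cases h : 1 ≤ γ.2.1 ∧ γ.2.1 ≤ D.last
  · refine .inr ⟨(γ.1, ⟨γ.2.1 - 1, by omega⟩, γ.2.2), rfl, ?_⟩
    rw [if_pos h, norm_mul, RCLike.norm_ofReal, abs_of_nonneg (pow_nonneg D.ρ_pos.le _)]
    rfl
  · exact .inl (by rw [if_neg h, RCLike.ofReal_zero, zero_mul])

lemma shift_mem_gelfandClass : D.shift 𝕜 ∈ gelfandClass 𝕜 (D.Carrier 𝕜) D.ρ 1 := by
  refine ⟨1, zero_le_one, 2 * D.last * 8, fun l => ?_⟩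
  have := D.finite_lt l
  have := Fintype.ofFinite {h // D.level h < l}
  refine ⟨Bool × Fin D.last × {h // D.level h < l}, inferInstance,
    fun i => D.shiftCoord 𝕜 (i.1, i.2.1, i.2.2), ?_, fun x => ?_⟩
  · have h := D.card_lt_le l
    rw [Nat.card_eq_fintype_card] at h
    rw [Fintype.card_prod, Fintype.card_prod, Fintype.card_bool, Fintype.card_fin]
    calc 2 * (D.last * Fintype.card {h // D.level h < l})
        ≤ 2 * (D.last * (8 * 4 ^ l)) := by gcongr
      _ = _ := by ring
  · have hsum : 0 ≤ ∑ i : Bool × Fin D.last × {h // D.level h < l},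
        ‖D.shiftCoord 𝕜 (i.1, i.2.1, i.2.2) x‖ := Finset.sum_nonneg fun _ _ => norm_nonneg _
    have hmain : 0 ≤ 1 * D.ρ ^ (1 * l) * ‖x‖ := by have := D.ρ_pos; positivity
    refine D.norm_le_of_coord 𝕜 _ (add_nonneg hmain hsum) fun γ => ?_
    obtain h0 | ⟨⟨b, t, h⟩, hγ, hi⟩ := D.norm_coord_shift_le 𝕜 γ x
    · rw [h0, norm_zero]; exact add_nonneg hmain hsum
    rw [hi, ← hγ]
    by_cases hl : D.level h < l
    · refine le_add_of_nonneg_of_le hmain ((mul_le_of_le_one_left (norm_nonneg _)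
        (D.ρ_pow_le_one _)).trans ?_)
      exact Finset.single_le_sum (f := fun i : Bool × Fin D.last × {h // D.level h < l} =>
        ‖D.shiftCoord 𝕜 (i.1, i.2.1, i.2.2) x‖) (fun _ _ => norm_nonneg _)
        (Finset.mem_univ (b, t, ⟨h, hl⟩))
    · refine le_add_of_le_of_nonneg ?_ hsum
      rw [one_mul, one_mul]
      exact mul_le_mul (pow_le_pow_of_le_one D.ρ_pos.le D.ρ_le_one (not_lt.1 hl))
        (D.norm_coord_apply_le 𝕜 _ x) (norm_nonneg _) (pow_nonneg D.ρ_pos.le _)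

lemma isQuasiPNuclear_shift [Countable G] {p : ℝ} (hp : 0 < p) (hρ : 4 * D.ρ ^ p < 1) :
    IsQuasiPNuclear p (D.shift 𝕜) := by
  let f : Bool × Fin D.last × G → D.Carrier 𝕜 →L[𝕜] 𝕜 := fun i =>
    ((D.ρ ^ D.level i.2.2 : ℝ) : 𝕜) • D.shiftCoord 𝕜 i
  have hfx : ∀ i x, ‖f i x‖ = D.ρ ^ D.level i.2.2 * ‖D.shiftCoord 𝕜 i x‖ := fun i x => by
    change ‖((D.ρ ^ D.level i.2.2 : ℝ) : 𝕜) • D.shiftCoord 𝕜 i x‖ = _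
    rw [norm_smul, RCLike.norm_ofReal, abs_of_nonneg (pow_nonneg D.ρ_pos.le _)]
  have hf : Summable fun i => ‖f i‖ ^ p := by
    have h0 : Summable fun i : Bool × Fin D.last × G => (D.ρ ^ p) ^ D.level i.2.2 := by
      have h1 : Summable fun i : (Bool × Fin D.last) × G => (1 : ℝ) * (D.ρ ^ p) ^ D.level i.2 :=
        Summable.mul_of_nonneg (f := fun _ : Bool × Fin D.last => (1 : ℝ)) Summable.of_finite
          (D.summable_pow _ (Real.rpow_nonneg D.ρ_pos.le _) hρ) (fun _ => zero_le_one)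
          fun _ => pow_nonneg (Real.rpow_nonneg D.ρ_pos.le _) _
      simpa [Function.comp_def] using (Equiv.prodAssoc Bool (Fin D.last) G).symm.summable_iff.2 h1
    refine h0.of_nonneg_of_le (fun _ => Real.rpow_nonneg (norm_nonneg _) _) fun i => ?_
    have h2 : ‖f i‖ ≤ D.ρ ^ D.level i.2.2 := by
      refine ContinuousLinearMap.opNorm_le_bound _ (pow_nonneg D.ρ_pos.le _) fun x => ?_
      rw [hfx]
      exact mul_le_mul_of_nonneg_left (D.norm_coord_apply_le 𝕜 _ x) (pow_nonneg D.ρ_pos.le _)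
    refine (Real.rpow_le_rpow (norm_nonneg _) h2 hp.le).trans_eq ?_
    rw [← Real.rpow_natCast, ← Real.rpow_natCast, ← Real.rpow_mul D.ρ_pos.le,
      ← Real.rpow_mul D.ρ_pos.le, mul_comm]
  refine .of_countable hp f hf fun x => ?_
  have hnn : 0 ≤ (∑' i, ‖f i x‖ ^ p) ^ (1 / p) :=
    Real.rpow_nonneg (tsum_nonneg fun _ => Real.rpow_nonneg (norm_nonneg _) _) _
  refine D.norm_le_of_coord 𝕜 _ hnn fun γ => ?_
  obtain h0 | ⟨i, hγ, hi⟩ := D.norm_coord_shift_le 𝕜 γ x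
  · rw [h0, norm_zero]; exact hnn
  · rw [hi, ← hγ, ← hfx]
    exact le_tsum_rpow hp (fun _ => norm_nonneg _) (summable_norm_apply_rpow hp hf x) i

lemma incl_mem_range_toBCF (x : D.Carrier 𝕜) : D.incl 𝕜 x ∈ Set.range
    (ZeroAtInftyContinuousMap.toBCF : ZeroAtInftyContinuousMap (Bool × ℕ × G) 𝕜 → _) := by
  let W : Submodule 𝕜 (BoundedContinuousFunction (Bool × ℕ × G) 𝕜) :=
    { carrier := Set.range ZeroAtInftyContinuousMap.toBCF
      add_mem' := by rintro _ _ ⟨x, rfl⟩ ⟨y, rfl⟩; exact ⟨x + y, rfl⟩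
      zero_mem' := ⟨0, rfl⟩
      smul_mem' := by rintro a _ ⟨x, rfl⟩; exact ⟨a • x, rfl⟩ }
  have : D.space 𝕜 ≤ W := by
    refine D.space_le 𝕜 ZeroAtInftyContinuousMap.isClosed_range_toBCF fun b s g => ?_
    refine ⟨⟨(D.gen 𝕜 b s g).toContinuousMap, ?_⟩, rfl⟩
    rw [cocompact_eq_cofinite]
    have hfin : (Set.univ ×ˢ {s} ×ˢ (D.row g).support : Set (Bool × ℕ × G)).Finite :=
      Set.finite_univ.prod ((Set.finite_singleton s).prod (Finset.finite_toSet _))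
    refine tendsto_const_nhds.congr' ?_
    filter_upwards [hfin.compl_mem_cofinite] with γ hγ
    change 0 = D.gen 𝕜 b s g γ
    rw [gen_apply]
    split_ifs with h
    · have : D.row g γ.2.2 = 0 := by
        by_contra h'
        exact hγ ⟨trivial, h.2.1, Finsupp.mem_support_iff.2 h'⟩
      rw [this, mul_zero, RCLike.ofReal_zero]
    · rfl
  exact this (D.incl_mem 𝕜 x)

lemma exists_isometry_zeroAtInfty [Countable G] [Nonempty G] :
    ∃ ι : D.Carrier 𝕜 →ₗᵢ[𝕜] ZeroAtInftyContinuousMap ℕ 𝕜, IsClosed (Set.range ι) := by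
  obtain ⟨e⟩ : Nonempty (ℕ ≃ Bool × ℕ × G) := nonempty_equiv_of_countable
  have hzero : ∀ x, Tendsto (fun n => D.incl 𝕜 x (e n)) (cocompact ℕ) (𝓝 0) := fun x => by
    obtain ⟨y, hy⟩ := D.incl_mem_range_toBCF 𝕜 x
    rw [← hy, cocompact_eq_cofinite]
    have := y.zero_at_infty'
    rw [cocompact_eq_cofinite] at this
    exact this.comp e.injective.tendsto_cofinite
  let L : D.Carrier 𝕜 →ₗ[𝕜] ZeroAtInftyContinuousMap ℕ 𝕜 :=
    { toFun := fun x => ⟨⟨fun n => D.incl 𝕜 x (e n), continuous_of_discreteTopology⟩, hzero x⟩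
      map_add' := fun x y => by ext n; change D.incl 𝕜 (x + y) (e n) = _; rw [map_add]; rfl
      map_smul' := fun a x => by ext n; change D.incl 𝕜 (a • x) (e n) = _; rw [map_smul]; rfl }
  have hL : ∀ x, ‖L x‖ = ‖x‖ := fun x => by
    rw [← ZeroAtInftyContinuousMap.norm_toBCF_eq_norm]
    refine le_antisymm ((BoundedContinuousFunction.norm_le (norm_nonneg _)).2 fun n =>
      D.norm_coord_apply_le 𝕜 (e n) x) (D.norm_le_of_coord 𝕜 x (norm_nonneg _) fun γ => ?_)
    have := (L x).toBCF.norm_coe_le_norm (e.symm γ)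
    change ‖D.incl 𝕜 x (e (e.symm γ))‖ ≤ _ at this
    rwa [e.apply_symm_apply] at this
  have : CompleteSpace (D.Carrier 𝕜) := by
    rw [completeSpace_iff_isComplete_range (D.incl 𝕜).isometry.isUniformInducing]
    exact (D.isClosed_range_incl 𝕜).isComplete
  exact ⟨⟨L, hL⟩, (AddMonoidHomClass.isometry_of_norm L hL).isClosedEmbedding.isClosed_range⟩

end SquareZeroModel

end Model

/-- The points of level less than `l`. -/
def davieBelow (l : ℕ) : Finset DaviePoint := (Finset.range l).sigma fun _ => Finset.univ

lemma mem_davieBelow (l : ℕ) (h : DaviePoint) : h ∈ davieBelow l ↔ h.1 < l := by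
  simp [davieBelow]

lemma card_davieBelow_le (l : ℕ) : (davieBelow l).card ≤ 8 * 4 ^ l := by
  simp only [davieBelow, Finset.card_sigma, Finset.card_univ, card_freq]
  induction l with
  | zero => simp
  | succ l ih => rw [Finset.sum_range_succ, pow_succ]; omega

/-- The model built on the matrix constructed above. -/
def davieModel (ρ : ℝ) (n : ℕ) (h0 : 0 < ρ) (h1 : ρ ≤ 1) (hn : 1 / 2 < ρ ^ n) :
    SquareZeroModel DaviePoint where
  level := Sigma.fst
  row := davieRow
  ρ := ρ
  last := n
  abs_row_le := abs_davieRow_le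
  linearCombination_row := linearCombination_davieRow
  hasSum_diag := hasSum_davieRow_self
  summable_pow x hx0 hx := by
    have hsum : Summable fun k : ℕ => (8 : ℝ) * (4 * x) ^ k :=
      (summable_geometric_of_lt_one (by positivity) hx).mul_left 8
    refine (summable_sigma_of_nonneg fun g => pow_nonneg hx0 _).2
      ⟨fun k => Summable.of_finite, hsum.congr fun k => ?_⟩
    change _ = ∑' _ : Freq (k + 1), x ^ k
    rw [tsum_const, Nat.card_eq_fintype_card, card_freq, nsmul_eq_mul, mul_pow]
    push_cast
    ring
  finite_lt l := (Finset.finite_toSet _).subset fun h => (mem_davieBelow l h).2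
  card_lt_le l := by
    rw [Nat.subtype_card _ (mem_davieBelow l)]
    exact card_davieBelow_le l
  ρ_pos := h0
  ρ_le_one := h1
  half_lt := hn

/-- The weight is chosen between the two critical exponents. -/
lemma exists_weight {n : ℕ} (hn : 1 ≤ n) {p : ℝ} (hp1 : 2 * (n : ℝ) < p)
    (hp2 : p ≤ 2 * ((n : ℝ) + 1)) :
    ∃ ρ : ℝ, 0 < ρ ∧ ρ ≤ 1 ∧ 1 / 2 < ρ ^ n ∧ 4 * ρ ^ p < 1 ∧ 2 * ρ ^ (n + 1) < 1 := by
  have hn0 : (0 : ℝ) < n := by exact_mod_cast hn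
  have hp0 : 0 < p := by linarith
  obtain ⟨e, he1, he2⟩ := exists_between (show 2 / p < 1 / (n : ℝ) by
    rw [div_lt_div_iff₀ hp0 hn0]; linarith)
  have he0 : 0 < e := lt_trans (by positivity) he1
  rw [div_lt_iff₀ hp0] at he1
  rw [lt_div_iff₀ hn0] at he2
  have hpow : ∀ k : ℕ, ((2 : ℝ) ^ (-e)) ^ k = 2 ^ (-(e * k)) := fun k => by
    rw [← Real.rpow_natCast, ← Real.rpow_mul zero_le_two, neg_mul]
  have hlt : ∀ x y : ℝ, x < y → (2 : ℝ) ^ x < 2 ^ y := fun x y =>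
    Real.rpow_lt_rpow_of_exponent_lt one_lt_two
  refine ⟨2 ^ (-e), by positivity, ?_, ?_, ?_, ?_⟩
  · exact Real.rpow_le_one_of_one_le_of_nonpos one_le_two (by linarith)
  · rw [hpow]
    have := hlt (-1) (-(e * n)) (by linarith)
    rwa [Real.rpow_neg_one, inv_eq_one_div] at this
  · rw [← Real.rpow_mul zero_le_two, neg_mul]
    have := hlt (-(e * p)) (-2) (by linarith)
    have h2 : (2 : ℝ) ^ (-2 : ℝ) = 1 / 4 := by
      rw [Real.rpow_neg zero_le_two]; norm_num
    rw [h2] at this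
    linarith
  · rw [hpow]
    have := hlt (-(e * (n + 1 : ℕ))) (-1) (by push_cast; nlinarith)
    rw [Real.rpow_neg_one] at this
    linarith

/-- Let `n ∈ ℕ` and `2n < p ≤ 2(n+1)`.  Then there exist a closed
subspace `Z_n` of `c_0` failing the approximation property and a closed subalgebra `M_n`
of the operator-norm closure of `QN_p(Z_n)` in `L(Z_n)` such that `M_n` is a closed
`(n+1)`-subideal of `L(Z_n)` but not a closed `n`-subideal of `L(Z_n)`. -/
theorem exists_quasiPNuclear_closed_subideal
    (𝕜 : Type) [RCLike 𝕜] (n : ℕ) (hn : 1 ≤ n) (p : ℝ)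
    (hp1 : 2 * (n : ℝ) < p) (hp2 : p ≤ 2 * ((n : ℝ) + 1)) :
    ∃ Z : BundledSp 𝕜,
      (∃ ι : Z.carrier →ₗᵢ[𝕜] ZeroAtInftyContinuousMap ℕ 𝕜,
        IsClosed (Set.range ι)) ∧
      ¬HasApproximationProperty 𝕜 Z.carrier ∧
      ∃ M : Set (Z.carrier →L[𝕜] Z.carrier),
        M ⊆ closure {T : Z.carrier →L[𝕜] Z.carrier | IsQuasiPNuclear p T} ∧
        IsClosedNSubideal 𝕜 (n + 1) M ∧ ¬IsClosedNSubideal 𝕜 n M := by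
  obtain ⟨ρ, h0, h1, hρn, hρp, hρ⟩ := exists_weight hn hp1 hp2
  have hp : 0 < p := lt_of_le_of_lt (by positivity) hp1
  let D := davieModel ρ n h0 h1 hρn
  let : TopologicalSpace DaviePoint := ⊥
  have : DiscreteTopology DaviePoint := ⟨rfl⟩
  refine ⟨⟨D.Carrier 𝕜⟩, D.exists_isometry_zeroAtInfty 𝕜, D.not_hasApproximationProperty 𝕜, ?_⟩
  refine exists_closed_subideal_of_functional hp h0.le h1 hρ (D.shift_mem_gelfandClass 𝕜)
    (D.isQuasiPNuclear_shift 𝕜 hp hρp) (T := D.proj 𝕜)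
    (D.layerTrace 𝕜 true n le_rfl - D.layerTrace 𝕜 false n le_rfl) (fun R hR => ?_)
    (fun j => ?_) ?_
  · rw [sub_apply, D.layerTrace_of_mem_rankOneSpan 𝕜 true n le_rfl hR,
      D.layerTrace_of_mem_rankOneSpan 𝕜 false n le_rfl hR, sub_zero]
  · rw [sub_apply, D.layerTrace_shift_pow 𝕜 true n le_rfl, D.layerTrace_shift_pow 𝕜 false n le_rfl,
      sub_self]
  · have ht := D.layerTrace_proj_mul_shift_pow 𝕜 true
    have hf := D.layerTrace_proj_mul_shift_pow 𝕜 false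
    change D.layerTrace 𝕜 true n le_rfl (D.proj 𝕜 * D.shift 𝕜 ^ n) = _ at ht
    change D.layerTrace 𝕜 false n le_rfl (D.proj 𝕜 * D.shift 𝕜 ^ n) = _ at hf
    rw [sub_apply, ht, hf]
    simp

end
end

section
/- Let A be a Banach algebra and let J be a closed 2-subideal of A. Then the closure of [J]_A³ is contained in J, where [J]_A = A·J + J·A + A·J·A + J is the two-sided ideal of A generated by J and [J]_A³ denotes the linear span of all products of three elements of [J]_A. -/
open Filter Topology

noncomputable section

/-- Products of `n + 1` elements of the set `S`. -/
def prodsOf {A : Type*} [Mul A] (S : Set A) : ℕ → Set A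
  | 0 => S
  | n + 1 => {x | ∃ y ∈ prodsOf S n, ∃ s ∈ S, x = y * s}

/-- The two-sided ideal `[S]_A = A·S + S·A + A·S·A + S` of `A` generated by the set `S`
(as a linear span). -/
def genIdeal (𝕜 : Type*) {A : Type*} [CommSemiring 𝕜] [NonUnitalNonAssocSemiring A]
    [Module 𝕜 A] (S : Set A) : Set A :=
  (Submodule.span 𝕜 ({x | ∃ a : A, ∃ s ∈ S, x = a * s} ∪ {x | ∃ a : A, ∃ s ∈ S, x = s * a} ∪
    {x | ∃ a b : A, ∃ s ∈ S, x = a * s * b} ∪ S) : Set A)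

/-- The two-sided ideal generated by a subset of a two-sided ideal `I` is contained in `I`. -/
theorem genIdeal_subset_of_isIdealOf {𝕜 A : Type*} [CommSemiring 𝕜]
    [NonUnitalNonAssocSemiring A] [Module 𝕜 A] {I T : NonUnitalSubalgebra 𝕜 A} {S : Set A}
    (hT : (T : Set A) = Set.univ) (hI : IsIdealOf I T) (hS : S ⊆ I) :
    genIdeal 𝕜 S ⊆ I := by
  have hmem (a : A) : a ∈ T := by simp [← SetLike.mem_coe, hT]
  refine (Submodule.span_le (p := I.toSubmodule)).2 ?_
  rintro x (((⟨a, s, hs, rfl⟩ | ⟨a, s, hs, rfl⟩) | ⟨a, b, s, hs, rfl⟩) | hs)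
  · exact (hI.2 a (hmem a) s (hS hs)).1
  · exact (hI.2 a (hmem a) s (hS hs)).2
  · exact (hI.2 b (hmem b) _ (hI.2 a (hmem a) s (hS hs)).1).2
  · exact hS hs

/-- If `J` is an ideal of `I` and `I` is an ideal of the whole algebra, then multiplying an
element of the ideal generated by `J` on both sides by elements of `I` lands in `J`. -/
theorem mul_genIdeal_mul_mem {𝕜 A : Type*} [CommSemiring 𝕜] [NonUnitalSemiring A]
    [Module 𝕜 A] [IsScalarTower 𝕜 A A] [SMulCommClass 𝕜 A A]
    {J I T : NonUnitalSubalgebra 𝕜 A}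
    (hT : (T : Set A) = Set.univ) (hI : IsIdealOf I T) (hJ : IsIdealOf J I) {x y z : A}
    (hx : x ∈ I) (hy : y ∈ I) (hz : z ∈ genIdeal 𝕜 (J : Set A)) : x * z * y ∈ J := by
  have hmem (a : A) : a ∈ T := by simp [← SetLike.mem_coe, hT]
  have key {u v s : A} (hu : u ∈ I) (hv : v ∈ I) (hs : s ∈ J) : u * s * v ∈ J :=
    (hJ.2 v hv _ (hJ.2 u hu s hs).1).2
  have hxa (a : A) : x * a ∈ I := (hI.2 a (hmem a) x hx).2
  have hay (a : A) : a * y ∈ I := (hI.2 a (hmem a) y hy).1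
  induction hz using Submodule.span_induction with
  | mem z hz =>
    obtain ((⟨a, s, hs, rfl⟩ | ⟨a, s, hs, rfl⟩) | ⟨a, b, s, hs, rfl⟩) | hs := hz
    · simpa only [mul_assoc] using key (hxa a) hy hs
    · simpa only [mul_assoc] using key hx (hay a) hs
    · simpa only [mul_assoc] using key (hxa a) (hay b) hs
    · exact key hx hy hs
  | zero => simp
  | add z w _ _ hz hw => simpa only [mul_add, add_mul] using add_mem hz hw
  | smul c z _ hz => simpa only [mul_smul_comm, smul_mul_assoc] using SMulMemClass.smul_mem c hz

/-- Let `A` be a Banach algebra and `J` a closed `2`-subideal of `A`.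
Then the closure of `[J]_A³` is contained in `J`, where `[J]_A` is the two-sided ideal of
`A` generated by `J` and `[J]_A³` is the linear span of all products of three elements of
`[J]_A`. -/
theorem closure_cube_of_generated_ideal_subset
    {𝕜 A : Type*} [RCLike 𝕜] [NonUnitalNormedRing A] [NormedSpace 𝕜 A]
    [IsScalarTower 𝕜 A A] [SMulCommClass 𝕜 A A] [CompleteSpace A]
    (J : Set A) (hJ : IsClosedNSubideal 𝕜 2 J) :
    closure ((Submodule.span 𝕜 (prodsOf (genIdeal 𝕜 J) 2) : Submodule 𝕜 A) : Set A) ⊆ J := by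
  obtain ⟨C, h0, rfl, hclosed, hideal⟩ := hJ
  have hI : IsIdealOf (C 1) (C 0) := hideal 0 (by norm_num)
  have hJ : IsIdealOf (C 2) (C 1) := hideal 1 (by norm_num)
  have hK := genIdeal_subset_of_isIdealOf h0 hI hJ.1
  refine closure_minimal ((Submodule.span_le (p := (C 2).toSubmodule)).2 ?_) (hclosed 2 le_rfl)
  rintro _ ⟨_, ⟨x, hx, z, hz, rfl⟩, y, hy, rfl⟩
  exact mul_genIdeal_mul_mem h0 hI hJ (hK hx) (hK hy) hz

end
end

section
/- Let n ∈ ℕ and let X be a Banach space for which there exist a closed two-sided ideal I of L(X) and an operator S ∈ I such that S^n does not belong to the operator-norm closure of I^{n+1}. Set Z = X ⊕ X, let J = {U ∈ L(Z) : all four matrix components of U with respect to the decomposition Z = X ⊕ X belong to I}, let T ∈ L(Z) be the operator with matrix [[S,0],[0,0]], and let M_n = span(T, T², …, Tⁿ) + closure(J^{n+1}). Then M_n is a closed (n+1)-subideal of L(Z) that is not a closed n-subideal of L(Z), and moreover: (i) the closure of [M_n]^{n+1} is strictly contained in M_n; (ii) [M_n]^n is not contained in M_n; where [M_n] denotes the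 two-sided ideal of L(Z) generated by M_n. -/
open Filter Topology

noncomputable section

section MatrixOps

variable {𝕜 X : Type*} [RCLike 𝕜] [NormedAddCommGroup X] [NormedSpace 𝕜 X]

/-- The four matrix components of an operator on `Z = X ⊕ X`. -/
def matComp11 (U : (X × X) →L[𝕜] (X × X)) : X →L[𝕜] X :=
  (ContinuousLinearMap.fst 𝕜 X X).comp (U.comp (ContinuousLinearMap.inl 𝕜 X X))

def matComp12 (U : (X × X) →L[𝕜] (X × X)) : X →L[𝕜] X :=
  (ContinuousLinearMap.fst 𝕜 X X).comp (U.comp (ContinuousLinearMap.inr 𝕜 X X))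

def matComp21 (U : (X × X) →L[𝕜] (X × X)) : X →L[𝕜] X :=
  (ContinuousLinearMap.snd 𝕜 X X).comp (U.comp (ContinuousLinearMap.inl 𝕜 X X))

def matComp22 (U : (X × X) →L[𝕜] (X × X)) : X →L[𝕜] X :=
  (ContinuousLinearMap.snd 𝕜 X X).comp (U.comp (ContinuousLinearMap.inr 𝕜 X X))

/-- `J = {U ∈ L(X ⊕ X) : all four matrix components of U lie in I}`. -/
def cornerIdeal (I : Set (X →L[𝕜] X)) : Set ((X × X) →L[𝕜] (X × X)) :=
  {U | matComp11 U ∈ I ∧ matComp12 U ∈ I ∧ matComp21 U ∈ I ∧ matComp22 U ∈ I}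

/-- The operator on `X ⊕ X` with matrix `[[S, 0], [0, 0]]`. -/
def diagOp (S : X →L[𝕜] X) : (X × X) →L[𝕜] (X × X) :=
  (ContinuousLinearMap.inl 𝕜 X X).comp (S.comp (ContinuousLinearMap.fst 𝕜 X X))

/-- `M_n = span(T, T², …, Tⁿ) + closure (J^{n+1})`, where `T = [[S, 0], [0, 0]]` and
`J` is the corner ideal associated to `I`. -/
def Mgen (I : Set (X →L[𝕜] X)) (S : X →L[𝕜] X) (n : ℕ) : Set ((X × X) →L[𝕜] (X × X)) :=
  {V | ∃ W ∈ Submodule.span 𝕜 {U : (X × X) →L[𝕜] (X × X) |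
      ∃ k : ℕ, 1 ≤ k ∧ k ≤ n ∧ U = diagOp S ^ k},
    ∃ C ∈ closure ((Submodule.span 𝕜 (prodsOf (cornerIdeal I) n) :
      Submodule 𝕜 ((X × X) →L[𝕜] (X × X))) : Set ((X × X) →L[𝕜] (X × X))),
    V = W + C}

end MatrixOps

/-- The closure of the span of the products of `k + 1` elements of `J`. -/
def closedPow {𝕜 A : Type*} [NontriviallyNormedField 𝕜] [NormedRing A] [NormedAlgebra 𝕜 A]
    (J : Submodule 𝕜 A) (k : ℕ) : Submodule 𝕜 A :=
  (Submodule.span 𝕜 (prodsOf (J : Set A) k)).topologicalClosure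

/-- The sum of `span (T, …, T ^ k)` and `closedPow J k`. -/
def powersAddClosedPow {𝕜 A : Type*} [NontriviallyNormedField 𝕜] [NormedRing A] [NormedAlgebra 𝕜 A]
    (J : Submodule 𝕜 A) (T : A) (k : ℕ) : Submodule 𝕜 A :=
  Submodule.span 𝕜 {U : A | ∃ i : ℕ, 1 ≤ i ∧ i ≤ k ∧ U = T ^ i} ⊔ closedPow J k

theorem prodsOf_mono {A : Type*} [Mul A] {S S' : Set A} (h : S ⊆ S') (k : ℕ) :
    prodsOf S k ⊆ prodsOf S' k := by
  induction k with
  | zero => exact h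
  | succ k ih =>
    rintro x ⟨y, hy, s, hs, rfl⟩
    exact ⟨y, ih hy, s, h hs, rfl⟩

theorem pow_succ_mem_prodsOf {A : Type*} [Monoid A] {S : Set A} {T : A} (hT : T ∈ S) (k : ℕ) :
    T ^ (k + 1) ∈ prodsOf S k := by
  induction k with
  | zero => simpa [prodsOf] using hT
  | succ k ih => exact ⟨_, ih, T, hT, pow_succ _ _⟩

section ClosedPow

variable {𝕜 A : Type*} [NontriviallyNormedField 𝕜] [NormedRing A] [NormedAlgebra 𝕜 A] {J : Submodule 𝕜 A}

theorem mul_mem_prodsOf_succ {x s : A} {k : ℕ} (hs : s ∈ J)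
    (hx : x ∈ prodsOf (J : Set A) k) : s * x ∈ prodsOf (J : Set A) (k + 1) := by
  induction k generalizing x with
  | zero => exact ⟨s, hs, x, hx, rfl⟩
  | succ k ih =>
    obtain ⟨y, hy, t, ht, rfl⟩ := hx
    exact ⟨s * y, ih hy, t, ht, (mul_assoc _ _ _).symm⟩

theorem prodsOf_succ_subset (hJ : ∀ a ∈ J, ∀ b ∈ J, a * b ∈ J) (k : ℕ) :
    prodsOf (J : Set A) (k + 1) ⊆ prodsOf (J : Set A) k := by
  induction k with
  | zero =>
    rintro _ ⟨y, hy, s, hs, rfl⟩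
    exact hJ y hy s hs
  | succ k ih =>
    rintro _ ⟨y, hy, s, hs, rfl⟩
    exact ⟨y, ih hy, s, hs, rfl⟩

theorem closedPow_antitone (hJ : ∀ a ∈ J, ∀ b ∈ J, a * b ∈ J) :
    Antitone (closedPow J) :=
  antitone_nat_of_succ_le fun k =>
    Submodule.topologicalClosure_mono (Submodule.span_mono (prodsOf_succ_subset hJ k))

theorem closedPow_le (hJ : ∀ a ∈ J, ∀ b ∈ J, a * b ∈ J) (hc : IsClosed (J : Set A)) (k : ℕ) :
    closedPow J k ≤ J :=
  (closedPow_antitone hJ (Nat.zero_le k)).trans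
    (Submodule.topologicalClosure_minimal _ (Submodule.span_le.2 subset_rfl) hc)

theorem map_mem_closedPow {B : Type*} [NormedRing B] [NormedAlgebra 𝕜 B] {L : Submodule 𝕜 B}
    (f : A →L[𝕜] B) {k l : ℕ} (hf : ∀ x ∈ prodsOf (J : Set A) k, f x ∈ closedPow L l)
    {x : A} (hx : x ∈ closedPow J k) : f x ∈ closedPow L l := by
  have h : closedPow J k ≤ (closedPow L l).comap f.toLinearMap :=
    Submodule.topologicalClosure_minimal _ (Submodule.span_le.2 hf)
      ((Submodule.isClosed_topologicalClosure _).preimage f.continuous)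
  exact h hx

theorem mem_closedPow_of_mem_prodsOf {x : A} {k : ℕ} (hx : x ∈ prodsOf (J : Set A) k) :
    x ∈ closedPow J k :=
  Submodule.le_topologicalClosure _ (Submodule.subset_span hx)

theorem closedPow_mul_mem {x s : A} {k : ℕ} (hx : x ∈ closedPow J k) (hs : s ∈ J) :
    x * s ∈ closedPow J (k + 1) := by
  refine map_mem_closedPow ((ContinuousLinearMap.mul 𝕜 A).flip s) (fun y hy => ?_) hx
  exact mem_closedPow_of_mem_prodsOf (k := k + 1) ⟨y, hy, s, hs, rfl⟩

theorem mul_closedPow_mem {x s : A} {k : ℕ} (hx : x ∈ closedPow J k) (hs : s ∈ J) :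
    s * x ∈ closedPow J (k + 1) := by
  refine map_mem_closedPow (ContinuousLinearMap.mul 𝕜 A s) (fun y hy => ?_) hx
  exact mem_closedPow_of_mem_prodsOf (mul_mem_prodsOf_succ hs hy)

theorem pow_mem_powersAddClosedPow (hJ : ∀ a ∈ J, ∀ b ∈ J, a * b ∈ J) {T : A} (hT : T ∈ J)
    {i : ℕ} (hi : 1 ≤ i) (k : ℕ) : T ^ i ∈ powersAddClosedPow J T k := by
  by_cases h : i ≤ k
  · exact Submodule.mem_sup_left (Submodule.subset_span ⟨i, hi, h, rfl⟩)
  · obtain ⟨m, rfl⟩ := Nat.exists_eq_add_of_le' hi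
    exact Submodule.mem_sup_right (closedPow_antitone hJ (by omega)
      (mem_closedPow_of_mem_prodsOf (pow_succ_mem_prodsOf hT m)))

theorem span_pow_le (hJ : ∀ a ∈ J, ∀ b ∈ J, a * b ∈ J) {T : A} (hT : T ∈ J) (k : ℕ) :
    Submodule.span 𝕜 {U : A | ∃ i : ℕ, 1 ≤ i ∧ i ≤ k ∧ U = T ^ i} ≤ J := by
  have h : ∀ m, T ^ (m + 1) ∈ J := fun m => by
    induction m with
    | zero => simpa using hT
    | succ m ih => exact pow_succ T (m + 1) ▸ hJ _ ih _ hT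
  refine Submodule.span_le.2 ?_
  rintro _ ⟨i, hi, -, rfl⟩
  obtain ⟨m, rfl⟩ := Nat.exists_eq_add_of_le' hi
  exact h m

theorem powersAddClosedPow_le (hJ : ∀ a ∈ J, ∀ b ∈ J, a * b ∈ J) (hc : IsClosed (J : Set A))
    {T : A} (hT : T ∈ J) (k : ℕ) : powersAddClosedPow J T k ≤ J :=
  sup_le (span_pow_le hJ hT k) (closedPow_le hJ hc k)

theorem powersAddClosedPow_zero (hJ : ∀ a ∈ J, ∀ b ∈ J, a * b ∈ J) (hc : IsClosed (J : Set A))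
    {T : A} (hT : T ∈ J) : powersAddClosedPow J T 0 = J :=
  le_antisymm (powersAddClosedPow_le hJ hc hT 0) fun _ hx =>
    Submodule.mem_sup_right (mem_closedPow_of_mem_prodsOf hx)

theorem powersAddClosedPow_succ_le (hJ : ∀ a ∈ J, ∀ b ∈ J, a * b ∈ J) {T : A} (hT : T ∈ J)
    (k : ℕ) : powersAddClosedPow J T (k + 1) ≤ powersAddClosedPow J T k := by
  refine sup_le (Submodule.span_le.2 ?_)
    ((closedPow_antitone hJ k.le_succ).trans le_sup_right)
  rintro _ ⟨i, hi, -, rfl⟩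
  exact pow_mem_powersAddClosedPow hJ hT hi k

theorem isClosed_powersAddClosedPow [CompleteSpace 𝕜] (J : Submodule 𝕜 A) (T : A) (k : ℕ) :
    IsClosed (powersAddClosedPow J T k : Set A) := by
  have hfin : {U : A | ∃ i : ℕ, 1 ≤ i ∧ i ≤ k ∧ U = T ^ i}.Finite := by
    refine ((Set.finite_Icc 1 k).image (T ^ ·)).subset ?_
    rintro _ ⟨i, hi, hk, rfl⟩
    exact ⟨i, ⟨hi, hk⟩, rfl⟩
  have := FiniteDimensional.span_of_finite 𝕜 hfin
  rw [powersAddClosedPow, sup_comm]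
  exact Submodule.isClosed_sup_finiteDimensional _ _ (Submodule.isClosed_topologicalClosure _)

theorem span_pow_mul_span_pow_mem (hJ : ∀ a ∈ J, ∀ b ∈ J, a * b ∈ J) {T : A} (hT : T ∈ J)
    {k l : ℕ} {x y : A}
    (hx : x ∈ Submodule.span 𝕜 {U : A | ∃ i : ℕ, 1 ≤ i ∧ i ≤ k ∧ U = T ^ i})
    (hy : y ∈ Submodule.span 𝕜 {U : A | ∃ i : ℕ, 1 ≤ i ∧ i ≤ l ∧ U = T ^ i}) (m : ℕ) :
    x * y ∈ powersAddClosedPow J T m := by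
  have h := Submodule.mul_mem_mul hx hy
  rw [Submodule.span_mul_span] at h
  refine Submodule.span_le.2 ?_ h
  rintro _ ⟨_, ⟨i, hi, -, rfl⟩, _, ⟨j, -, -, rfl⟩, rfl⟩
  simpa only [← pow_add, SetLike.mem_coe] using pow_mem_powersAddClosedPow hJ hT (Nat.le_add_right_of_le hi) m

theorem mul_mem_powersAddClosedPow (hJ : ∀ a ∈ J, ∀ b ∈ J, a * b ∈ J) (hc : IsClosed (J : Set A))
    {T : A} (hT : T ∈ J) {k l m : ℕ} (hk : m ≤ k + 1) (hl : m ≤ l + 1) {x y : A}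
    (hx : x ∈ powersAddClosedPow J T k) (hy : y ∈ powersAddClosedPow J T l) :
    x * y ∈ powersAddClosedPow J T m := by
  have hyJ := powersAddClosedPow_le hJ hc hT l hy
  obtain ⟨w, hw, c, hcK, rfl⟩ := Submodule.mem_sup.1 hx
  obtain ⟨w', hw', c', hcK', rfl⟩ := Submodule.mem_sup.1 hy
  rw [add_mul, mul_add]
  exact add_mem (add_mem (span_pow_mul_span_pow_mem hJ hT hw hw' m)
    (Submodule.mem_sup_right (closedPow_antitone hJ hl
      (mul_closedPow_mem hcK' (span_pow_le hJ hT k hw)))))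
    (Submodule.mem_sup_right (closedPow_antitone hJ hk (closedPow_mul_mem hcK hyJ)))

theorem isClosedNSubideal_powersAddClosedPow [CompleteSpace 𝕜] (hc : IsClosed (J : Set A))
    (hJ : ∀ a, ∀ x ∈ J, a * x ∈ J ∧ x * a ∈ J) {T : A} (hT : T ∈ J) (n : ℕ) :
    IsClosedNSubideal 𝕜 (n + 1) (powersAddClosedPow J T n : Set A) := by
  have hJ' : ∀ a ∈ J, ∀ b ∈ J, a * b ∈ J := fun a _ b hb => (hJ a b hb).1
  let D : ℕ → NonUnitalSubalgebra 𝕜 A := fun k =>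
    { powersAddClosedPow J T k with
      mul_mem' := mul_mem_powersAddClosedPow hJ' hc hT k.le_succ k.le_succ }
  have hD : ∀ k x, x ∈ D k ↔ x ∈ powersAddClosedPow J T k := fun _ _ => Iff.rfl
  refine ⟨fun k => Nat.casesOn k ⊤ D, rfl, rfl, fun k _ => ?_, fun k _ => ?_⟩
  · cases k with
    | zero => exact isClosed_univ
    | succ k => exact isClosed_powersAddClosedPow J T k
  · cases k with
    | zero =>
      refine ⟨Set.subset_univ _, fun a _ x hx => ?_⟩
      simp only [hD, powersAddClosedPow_zero hJ' hc hT] at hx ⊢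
      exact hJ a x hx
    | succ k =>
      exact ⟨powersAddClosedPow_succ_le hJ' hT k, fun a ha x hx =>
        ⟨mul_mem_powersAddClosedPow hJ' hc hT le_rfl (Nat.le_succ _) ha hx,
          mul_mem_powersAddClosedPow hJ' hc hT (Nat.le_succ _) le_rfl hx ha⟩⟩

end ClosedPow

theorem pow_mul_mem_of_isClosedNSubideal {𝕜 A : Type*} [CommSemiring 𝕜] [Semiring A] [Module 𝕜 A]
    [TopologicalSpace A] {n : ℕ} {M : Set A} (hM : IsClosedNSubideal 𝕜 n M) {T : A} (hT : T ∈ M)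
    (a : A) : T ^ n * a ∈ M := by
  obtain ⟨C, h0, rfl, -, hC⟩ := hM
  have hTC : ∀ k ≤ n, T ∈ C k := fun k hk =>
    Nat.decreasingInduction' (P := fun k => T ∈ C k) (fun j hj _ h => (hC j hj).1 h) hk hT
  have h : ∀ k ≤ n, T ^ k * a ∈ C k := fun k => by
    induction k with
    | zero =>
      intro _
      rw [← SetLike.mem_coe, h0]
      exact Set.mem_univ _
    | succ k ih =>
      intro hk
      rw [pow_succ', mul_assoc]
      exact ((hC k hk).2 _ (ih (by omega)) _ (hTC _ hk)).2
  exact h n le_rfl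

theorem pow_mul_mem_prodsOf_genIdeal {𝕜 A : Type*} [CommSemiring 𝕜] [Semiring A] [Module 𝕜 A]
    {M : Set A} {T : A} (hT : T ∈ M) (a : A) (k : ℕ) :
    T ^ (k + 1) * a ∈ prodsOf (genIdeal 𝕜 M) k := by
  have hTa : T * a ∈ genIdeal 𝕜 M :=
    Submodule.subset_span (.inl (.inl (.inr ⟨a, T, hT, rfl⟩)))
  have hT' : T ∈ genIdeal 𝕜 M := Submodule.subset_span (.inr hT)
  cases k with
  | zero => simpa [prodsOf] using hTa
  | succ k =>
    exact ⟨T ^ (k + 1), pow_succ_mem_prodsOf hT' k, T * a, hTa, by rw [pow_succ, mul_assoc]⟩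

theorem genIdeal_subset {𝕜 A : Type*} [CommSemiring 𝕜] [Semiring A] [Module 𝕜 A]
    {J : Submodule 𝕜 A} (hJ : ∀ a, ∀ x ∈ J, a * x ∈ J ∧ x * a ∈ J) {M : Set A}
    (hM : M ⊆ (J : Set A)) : genIdeal 𝕜 M ⊆ (J : Set A) := by
  refine Submodule.span_le.2 ?_
  rintro _ (((⟨a, s, hs, rfl⟩ | ⟨a, s, hs, rfl⟩) | ⟨a, b, s, hs, rfl⟩) | hs)
  · exact (hJ a s (hM hs)).1
  · exact (hJ a s (hM hs)).2
  · exact (hJ b _ (hJ a s (hM hs)).1).2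
  · exact hM hs

section MatrixEntries

variable {𝕜 X : Type*} [RCLike 𝕜] [NormedAddCommGroup X] [NormedSpace 𝕜 X]

/-- The map `U ↦ p ∘ U ∘ q`, as a continuous linear map. -/
def entryL (p : (X × X) →L[𝕜] X) (q : X →L[𝕜] (X × X)) :
    ((X × X) →L[𝕜] (X × X)) →L[𝕜] (X →L[𝕜] X) :=
  (ContinuousLinearMap.compL 𝕜 X (X × X) X p).comp
    ((ContinuousLinearMap.compL 𝕜 X (X × X) (X × X)).flip q)

@[simp]
theorem entryL_apply (p : (X × X) →L[𝕜] X) (q : X →L[𝕜] (X × X))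
    (U : (X × X) →L[𝕜] (X × X)) (x : X) : entryL p q U x = p (U (q x)) := rfl

theorem entryL_mul (p : (X × X) →L[𝕜] X) (q : X →L[𝕜] (X × X)) (U V : (X × X) →L[𝕜] (X × X)) :
    entryL p q (U * V) =
      entryL p (.inl 𝕜 X X) U * entryL (.fst 𝕜 X X) q V +
        entryL p (.inr 𝕜 X X) U * entryL (.snd 𝕜 X X) q V := by
  ext x
  simp [← map_add]

/-- The corner ideal of a submodule of `L(X)`, as a submodule of `L(X ⊕ X)`. -/
def cornerSubmodule (I : Submodule 𝕜 (X →L[𝕜] X)) : Submodule 𝕜 ((X × X) →L[𝕜] (X × X)) where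
  carrier := cornerIdeal (I : Set (X →L[𝕜] X))
  zero_mem' := by
    simp [cornerIdeal, matComp11, matComp12, matComp21, matComp22]
  add_mem' := by
    rintro U V ⟨h1, h2, h3, h4⟩ ⟨h1', h2', h3', h4'⟩
    simp only [cornerIdeal, matComp11, matComp12, matComp21, matComp22, Set.mem_ofPred_eq,
      ContinuousLinearMap.add_comp, ContinuousLinearMap.comp_add]
    exact ⟨add_mem h1 h1', add_mem h2 h2', add_mem h3 h3', add_mem h4 h4'⟩
  smul_mem' := by
    rintro c U ⟨h1, h2, h3, h4⟩
    simp only [cornerIdeal, matComp11, matComp12, matComp21, matComp22, Set.mem_ofPred_eq,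
      ContinuousLinearMap.smul_comp, ContinuousLinearMap.comp_smul]
    exact ⟨I.smul_mem c h1, I.smul_mem c h2, I.smul_mem c h3, I.smul_mem c h4⟩

variable {I : Submodule 𝕜 (X →L[𝕜] X)}

theorem mem_cornerSubmodule {U : (X × X) →L[𝕜] (X × X)} :
    U ∈ cornerSubmodule I ↔
      entryL (.fst 𝕜 X X) (.inl 𝕜 X X) U ∈ I ∧ entryL (.fst 𝕜 X X) (.inr 𝕜 X X) U ∈ I ∧
        entryL (.snd 𝕜 X X) (.inl 𝕜 X X) U ∈ I ∧ entryL (.snd 𝕜 X X) (.inr 𝕜 X X) U ∈ I :=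
  Iff.rfl

theorem isClosed_cornerSubmodule (hI : IsClosed (I : Set (X →L[𝕜] X))) :
    IsClosed (cornerSubmodule I : Set ((X × X) →L[𝕜] (X × X))) :=
  (hI.preimage (entryL _ _).continuous).inter <| (hI.preimage (entryL _ _).continuous).inter <|
    (hI.preimage (entryL _ _).continuous).inter (hI.preimage (entryL _ _).continuous)

theorem cornerSubmodule_mul_mem (hI : ∀ a, ∀ x ∈ I, a * x ∈ I ∧ x * a ∈ I)
    (a : (X × X) →L[𝕜] (X × X)) (U : (X × X) →L[𝕜] (X × X)) (hU : U ∈ cornerSubmodule I) :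
    a * U ∈ cornerSubmodule I ∧ U * a ∈ cornerSubmodule I := by
  obtain ⟨h1, h2, h3, h4⟩ := mem_cornerSubmodule.1 hU
  simp only [mem_cornerSubmodule, entryL_mul]
  exact ⟨⟨add_mem (hI _ _ h1).1 (hI _ _ h3).1, add_mem (hI _ _ h2).1 (hI _ _ h4).1,
      add_mem (hI _ _ h1).1 (hI _ _ h3).1, add_mem (hI _ _ h2).1 (hI _ _ h4).1⟩,
    ⟨add_mem (hI _ _ h1).2 (hI _ _ h2).2, add_mem (hI _ _ h1).2 (hI _ _ h2).2,
      add_mem (hI _ _ h3).2 (hI _ _ h4).2, add_mem (hI _ _ h3).2 (hI _ _ h4).2⟩⟩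

theorem prodsOf_cornerSubmodule_subset (k : ℕ) :
    prodsOf (cornerSubmodule I : Set ((X × X) →L[𝕜] (X × X))) k ⊆
      (cornerSubmodule (Submodule.span 𝕜 (prodsOf (I : Set (X →L[𝕜] X)) k)) : Set _) := by
  induction k with
  | zero =>
    rintro U ⟨h1, h2, h3, h4⟩
    exact ⟨Submodule.subset_span h1, Submodule.subset_span h2, Submodule.subset_span h3,
      Submodule.subset_span h4⟩
  | succ k ih =>
    have hmul : ∀ y ∈ Submodule.span 𝕜 (prodsOf (I : Set (X →L[𝕜] X)) k), ∀ s ∈ I,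
        y * s ∈ Submodule.span 𝕜 (prodsOf (I : Set (X →L[𝕜] X)) (k + 1)) := by
      intro y hy s hs
      have h : Submodule.span 𝕜 (prodsOf (I : Set (X →L[𝕜] X)) k) ≤
          (Submodule.span 𝕜 (prodsOf (I : Set (X →L[𝕜] X)) (k + 1))).comap
            (LinearMap.mulRight 𝕜 s) :=
        Submodule.span_le.2 fun z hz => Submodule.subset_span ⟨z, hz, s, hs, rfl⟩
      exact h hy
    rintro _ ⟨y, hy, s, hs, rfl⟩
    obtain ⟨h1, h2, h3, h4⟩ := mem_cornerSubmodule.1 hs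
    obtain ⟨k1, k2, k3, k4⟩ := mem_cornerSubmodule.1 (ih hy)
    rw [SetLike.mem_coe, mem_cornerSubmodule]
    simp only [entryL_mul]
    exact ⟨add_mem (hmul _ k1 _ h1) (hmul _ k2 _ h3), add_mem (hmul _ k1 _ h2) (hmul _ k2 _ h4),
      add_mem (hmul _ k3 _ h1) (hmul _ k4 _ h3), add_mem (hmul _ k3 _ h2) (hmul _ k4 _ h4)⟩

theorem entryL_fst_inl_mem_closedPow {k : ℕ} {U : (X × X) →L[𝕜] (X × X)}
    (hU : U ∈ closedPow (cornerSubmodule I) k) :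
    entryL (.fst 𝕜 X X) (.inl 𝕜 X X) U ∈ closedPow I k := by
  refine map_mem_closedPow _ (fun V hV => ?_) hU
  have h := prodsOf_cornerSubmodule_subset k hV
  exact Submodule.le_topologicalClosure _ (mem_cornerSubmodule.1 h).1

theorem entryL_fst_inr_mem_closedPow {k : ℕ} {U : (X × X) →L[𝕜] (X × X)}
    (hU : U ∈ closedPow (cornerSubmodule I) k) :
    entryL (.fst 𝕜 X X) (.inr 𝕜 X X) U ∈ closedPow I k := by
  refine map_mem_closedPow _ (fun V hV => ?_) hU
  have h := prodsOf_cornerSubmodule_subset k hV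
  exact Submodule.le_topologicalClosure _ (mem_cornerSubmodule.1 h).2.1

theorem diagOp_pow_succ (S : X →L[𝕜] X) (k : ℕ) : diagOp S ^ (k + 1) = diagOp (S ^ (k + 1)) := by
  induction k with
  | zero => simp
  | succ k ih =>
    rw [pow_succ, ih, pow_succ S]
    ext x <;> simp [diagOp]

theorem diagOp_mem_cornerSubmodule {S : X →L[𝕜] X} (hS : S ∈ I) :
    diagOp S ∈ cornerSubmodule I := by
  have h (q) : entryL (.snd 𝕜 X X) q (diagOp S) = 0 := by ext; simp [diagOp]
  refine mem_cornerSubmodule.2 ⟨hS, ?_, ?_, ?_⟩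
  · convert I.zero_mem
    ext; simp [diagOp]
  · rw [h]; exact I.zero_mem
  · rw [h]; exact I.zero_mem

theorem entryL_fst_inr_mem_of_mem_powersAddClosedPow {S : X →L[𝕜] X} {k : ℕ}
    {U : (X × X) →L[𝕜] (X × X)}
    (hU : U ∈ powersAddClosedPow (cornerSubmodule I) (diagOp S) k) :
    entryL (.fst 𝕜 X X) (.inr 𝕜 X X) U ∈ closedPow I k := by
  have h : powersAddClosedPow (cornerSubmodule I) (diagOp S) k ≤
      (closedPow I k).comap (entryL (.fst 𝕜 X X) (.inr 𝕜 X X)).toLinearMap := by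
    refine sup_le (Submodule.span_le.2 ?_) fun _ => entryL_fst_inr_mem_closedPow
    rintro _ ⟨i, hi, -, rfl⟩
    obtain ⟨m, rfl⟩ := Nat.exists_eq_add_of_le' hi
    have h0 : entryL (.fst 𝕜 X X) (.inr 𝕜 X X) (diagOp S ^ (m + 1)) = 0 := by
      rw [diagOp_pow_succ]
      ext x
      simp [diagOp]
    simp [h0]
  exact h hU

theorem Mgen_eq_powersAddClosedPow (I : Submodule 𝕜 (X →L[𝕜] X)) (S : X →L[𝕜] X) (n : ℕ) :
    Mgen (I : Set (X →L[𝕜] X)) S n =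
      (powersAddClosedPow (cornerSubmodule I) (diagOp S) n : Set _) := by
  ext V
  simp only [SetLike.mem_coe, powersAddClosedPow, Submodule.mem_sup, eq_comm (b := V)]
  rfl

end MatrixEntries

/-- Let `n ∈ ℕ` and let `X` be a Banach space with a closed two-sided
ideal `I` of `L(X)` and `S ∈ I` such that `S^n ∉ closure (I^{n+1})`.  With `Z = X ⊕ X`,
`J` the corresponding corner ideal, `T = [[S,0],[0,0]]` and
`M_n = span(T, …, Tⁿ) + closure (J^{n+1})`:  `M_n` is a closed `(n+1)`-subideal of `L(Z)`
which is not a closed `n`-subideal of `L(Z)`, and moreover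
(i) `closure ([M_n]^{n+1}) ⊊ M_n` and (ii) `[M_n]^n ⊄ M_n`,
where `[M_n]` is the two-sided ideal of `L(Z)` generated by `M_n`. -/
theorem Mgen_subideal_powers
    {𝕜 X : Type*} [RCLike 𝕜] [NormedAddCommGroup X] [NormedSpace 𝕜 X] [CompleteSpace X]
    (n : ℕ) (hn : 1 ≤ n)
    (I : NonUnitalSubalgebra 𝕜 (X →L[𝕜] X))
    (hIclosed : IsClosed (I : Set (X →L[𝕜] X)))
    (hIideal : ∀ a : X →L[𝕜] X, ∀ x ∈ I, a * x ∈ I ∧ x * a ∈ I)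
    (S : X →L[𝕜] X) (hSI : S ∈ I)
    (hS : S ^ n ∉
      closure ((Submodule.span 𝕜 (prodsOf (I : Set (X →L[𝕜] X)) n) : Submodule 𝕜 (X →L[𝕜] X)) :
        Set (X →L[𝕜] X))) :
    IsClosedNSubideal 𝕜 (n + 1) (Mgen (I : Set (X →L[𝕜] X)) S n) ∧
    ¬IsClosedNSubideal 𝕜 n (Mgen (I : Set (X →L[𝕜] X)) S n) ∧
    closure ((Submodule.span 𝕜
        (prodsOf (genIdeal 𝕜 (Mgen (I : Set (X →L[𝕜] X)) S n)) n) :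
        Submodule 𝕜 ((X × X) →L[𝕜] (X × X))) : Set ((X × X) →L[𝕜] (X × X))) ⊂
      Mgen (I : Set (X →L[𝕜] X)) S n ∧
    ¬(((Submodule.span 𝕜
        (prodsOf (genIdeal 𝕜 (Mgen (I : Set (X →L[𝕜] X)) S n)) (n - 1)) :
        Submodule 𝕜 ((X × X) →L[𝕜] (X × X))) : Set ((X × X) →L[𝕜] (X × X))) ⊆
      Mgen (I : Set (X →L[𝕜] X)) S n) := by
  have hM := Mgen_eq_powersAddClosedPow I.toSubmodule S n
  set M := Mgen (I : Set (X →L[𝕜] X)) S n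
  change M = _ at hM
  have hJ := cornerSubmodule_mul_mem (I := I.toSubmodule) hIideal
  have hJ' : ∀ a ∈ cornerSubmodule I.toSubmodule, ∀ b ∈ cornerSubmodule I.toSubmodule,
      a * b ∈ cornerSubmodule I.toSubmodule := fun a _ b hb => (hJ a b hb).1
  have hc := isClosed_cornerSubmodule (I := I.toSubmodule) hIclosed
  have hT := diagOp_mem_cornerSubmodule (I := I.toSubmodule) hSI
  have hTM : ∀ i, 1 ≤ i → diagOp S ^ i ∈ M := fun i hi =>
    hM ▸ pow_mem_powersAddClosedPow hJ' hT hi n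
  have hTM1 : diagOp S ∈ M := by simpa using hTM 1 le_rfl
  obtain ⟨m, rfl⟩ := Nat.exists_eq_add_of_le' hn
  have hnot : diagOp S ^ (m + 1) *
      (ContinuousLinearMap.inl 𝕜 X X).comp (ContinuousLinearMap.snd 𝕜 X X) ∉ M := by
    rw [hM]
    intro h
    have h' := entryL_fst_inr_mem_of_mem_powersAddClosedPow h
    rw [diagOp_pow_succ] at h'
    exact hS h'
  refine ⟨hM ▸ isClosedNSubideal_powersAddClosedPow hc hJ hT (m + 1),
    fun h => hnot (pow_mul_mem_of_isClosedNSubideal h hTM1 _), ?_,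
    fun h => hnot (h (Submodule.subset_span (pow_mul_mem_prodsOf_genIdeal hTM1 _ m)))⟩
  have hsub : closure (Submodule.span 𝕜 (prodsOf (genIdeal 𝕜 M) (m + 1)) :
      Set ((X × X) →L[𝕜] (X × X))) ⊆ closedPow (cornerSubmodule I.toSubmodule) (m + 1) :=
    closure_mono (Submodule.span_mono (prodsOf_mono
      (genIdeal_subset hJ (hM ▸ powersAddClosedPow_le hJ' hc hT (m + 1))) (m + 1)))
  refine (Set.ssubset_iff_of_subset (hsub.trans ?_)).2
    ⟨diagOp S ^ (m + 1), hTM _ hn, fun h => hS ?_⟩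
  · rw [hM]
    exact fun _ hx => Submodule.mem_sup_right hx
  · have h' := entryL_fst_inl_mem_closedPow (hsub h)
    rw [diagOp_pow_succ] at h'
    exact h'

end
end
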